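/- Let E be a Riesz space with point separating order dual E^~. The Arens homomorphism γ : ((Orth(E))^~)_n^~ → L_b(E^~), defined by γ(F)(f) = F•f, is a unital algebra homomorphism and an order continuous Riesz (lattice) homomorphism, and its range is contained in Orth(E^~). -/

import Mathlib

noncomputable section

open Set

/-- A map between preordered sets is *order bounded* if it maps order intervals into
order intervals. -/
def IsOrdBdd {E F : Type*} [Preorder E] [Preorder F] (f : E → F) : Prop :=
  ∀ a b : E, ∃ c d : F, ∀ x : E, a ≤ x → x ≤ b → c ≤ f x ∧ f x ≤ d

/-- A map of a Riesz space is *band preserving* if it preserves disjointness. -/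
def IsBandPres {E : Type*} [Lattice E] [AddCommGroup E] (T : E → E) : Prop :=
  ∀ x y : E, |x| ⊓ |y| = 0 → |T x| ⊓ |y| = 0

/-- An *orthomorphism*: an order bounded, band preserving linear map. -/
def IsOrtho {E : Type*} [Lattice E] [AddCommGroup E] [Module ℝ E] (T : E → E) : Prop :=
  IsLinearMap ℝ T ∧ IsOrdBdd T ∧ IsBandPres T

/-- A member of the *ideal center* `Z(E)`: an orthomorphism dominated by a multiple of the
identity. -/
def IsCentral {E : Type*} [Lattice E] [AddCommGroup E] [Module ℝ E] (T : E → E) : Prop :=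
  IsOrtho T ∧ ∃ c : ℝ, ∀ x : E, 0 ≤ x → -(c • x) ≤ T x ∧ T x ≤ c • x

/-- Order continuity of a real functional: it converges to `0` along every downward
directed system with infimum `0`. -/
def IsOrderContinuousFun {X : Type*} [Lattice X] [AddCommGroup X] (φ : X → ℝ) : Prop :=
  ∀ s : Set X, s.Nonempty → DirectedOn (· ≥ ·) s → IsGLB s 0 →
    ∀ ε : ℝ, 0 < ε → ∃ x ∈ s, ∀ y ∈ s, y ≤ x → |φ y| < ε

/-- `p` realizes the Riesz space `D` as the order dual `E^∼` of `E`. -/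
structure IsOrderDual (E D : Type*) [Lattice E] [AddCommGroup E] [Module ℝ E]
    [Lattice D] [AddCommGroup D] [Module ℝ D] (p : D → E → ℝ) : Prop where
  lin_fun : ∀ f : D, IsLinearMap ℝ (p f)
  lin_vec : ∀ x : E, IsLinearMap ℝ fun f => p f x
  bdd : ∀ f : D, IsOrdBdd (p f)
  inj : ∀ f g : D, (∀ x, p f x = p g x) → f = g
  surj : ∀ φ : E → ℝ, IsLinearMap ℝ φ → IsOrdBdd φ → ∃ f : D, ∀ x, p f x = φ x
  le_iff : ∀ f g : D, f ≤ g ↔ ∀ x : E, 0 ≤ x → p f x ≤ p g x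

/-- `p` realizes the Riesz space `B` as the order continuous order dual `(X^∼)ₙ` of `X`
(used for `X = A^∼`, giving `B = (A^∼)ₙ^∼`). -/
structure IsOrderContinuousDual (X B : Type*) [Lattice X] [AddCommGroup X] [Module ℝ X]
    [Lattice B] [AddCommGroup B] [Module ℝ B] (p : B → X → ℝ) : Prop where
  lin_fun : ∀ F : B, IsLinearMap ℝ (p F)
  lin_vec : ∀ f : X, IsLinearMap ℝ fun F => p F f
  bdd : ∀ F : B, IsOrdBdd (p F)
  cont : ∀ F : B, IsOrderContinuousFun (p F)
  inj : ∀ F G : B, (∀ f, p F f = p G f) → F = G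
  surj : ∀ φ : X → ℝ, IsLinearMap ℝ φ → IsOrdBdd φ → IsOrderContinuousFun φ →
    ∃ F : B, ∀ f, p F f = φ f
  le_iff : ∀ F G : B, F ≤ G ↔ ∀ f : X, 0 ≤ f → p F f ≤ p G f

/-- `ρ` realizes the lattice-ordered algebra `O` as the `f`-algebra `Orth(E)` of all
orthomorphisms of `E`. -/
structure IsOrthAlg (E O : Type*) [Lattice E] [AddCommGroup E] [Module ℝ E]
    [Lattice O] [Ring O] [Module ℝ O] (ρ : O → E → E) : Prop where
  ortho : ∀ a : O, IsOrtho (ρ a)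
  lin_vec : ∀ x : E, IsLinearMap ℝ fun a => ρ a x
  map_one : ∀ x : E, ρ 1 x = x
  map_mul : ∀ (a b : O) (x : E), ρ (a * b) x = ρ a (ρ b x)
  inj : ∀ a b : O, (∀ x, ρ a x = ρ b x) → a = b
  surj : ∀ T : E → E, IsOrtho T → ∃ a : O, ∀ x, ρ a x = T x
  le_iff : ∀ a b : O, a ≤ b ↔ ∀ x : E, 0 ≤ x → ρ a x ≤ ρ b x

/-- `ρ` realizes the normed lattice-ordered algebra `Z` as the ideal center `Z(E)` of `E`,
an AM-space whose norm is the order unit norm (the order/algebra unit being `id`). -/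
structure IsCenterOf (E Z : Type*) [Lattice E] [AddCommGroup E] [Module ℝ E]
    [Lattice Z] [NormedRing Z] [NormedAlgebra ℝ Z] (ρ : Z → E → E) : Prop where
  central : ∀ a : Z, IsCentral (ρ a)
  lin_vec : ∀ x : E, IsLinearMap ℝ fun a => ρ a x
  map_one : ∀ x : E, ρ 1 x = x
  map_mul : ∀ (a b : Z) (x : E), ρ (a * b) x = ρ a (ρ b x)
  inj : ∀ a b : Z, (∀ x, ρ a x = ρ b x) → a = b
  surj : ∀ T : E → E, IsCentral T → ∃ a : Z, ∀ x, ρ a x = T x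
  le_iff : ∀ a b : Z, a ≤ b ↔ ∀ x : E, 0 ≤ x → ρ a x ≤ ρ b x
  norm_le_iff : ∀ (a : Z) (c : ℝ), 0 ≤ c →
    (‖a‖ ≤ c ↔ ∀ x : E, 0 ≤ x → -(c • x) ≤ ρ a x ∧ ρ a x ≤ c • x)

/-- The pairing `p : D → E → ℝ` separates the points of `E`. -/
def SepPoints {E D : Type*} [Zero E] (p : D → E → ℝ) : Prop :=
  ∀ x : E, (∀ f : D, p f x = 0) → x = 0

/-- `y` belongs to the `σ(E,D)`-closure of `s ⊆ E`, for the pairing `p : D → E → ℝ`. -/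
def InWeakClosure {E D : Type*} (p : D → E → ℝ) (s : Set E) (y : E) : Prop :=
  ∀ (fs : Finset D) (ε : ℝ), 0 < ε → ∃ z ∈ s, ∀ f ∈ fs, |p f z - p f y| < ε

/-- `E` has a *topologically full center*: for each `x ∈ E₊` the `σ(E,E^∼)`-closure of
`Z(E)x` contains the order ideal generated by `x`.  Here `p : D → E → ℝ` is the duality
with `E^∼` and `ρ : Z → E → E` is the action of the ideal center. -/
def TopFullCenter {E D Z : Type*} [Lattice E] [AddCommGroup E] [Module ℝ E]
    (p : D → E → ℝ) (ρ : Z → E → E) : Prop :=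
  ∀ x : E, 0 ≤ x → ∀ y : E, (∃ c : ℝ, 0 ≤ c ∧ |y| ≤ c • x) →
    InWeakClosure p {z | ∃ T : Z, ρ T x = z} y

/-- `FG` is the Arens product `F ⬝ G` in the order bidual `B` of the algebra `A`:
`(F⬝G)(f) = F(G⬝f)`, `(G⬝f)(a) = G(f⬝a)`, `(f⬝a)(b) = f(ab)`; `pA : DA → A → ℝ` is the
duality of `A` with `A^∼` and `pB : B → DA → ℝ` that of `(A^∼)ₙ^∼` with `A^∼`. -/
def IsArensProduct {A DA B : Type*} [Mul A] (pA : DA → A → ℝ) (pB : B → DA → ℝ)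
    (F G FG : B) : Prop :=
  ∀ f Gf : DA,
    (∀ (a : A) (fa : DA), (∀ b : A, pA fa b = pA f (a * b)) → pA Gf a = pB G fa) →
    pB FG f = pB F Gf

/-- The ring structure of `B` is the Arens multiplication inherited from `A`, with unit the
canonical image of `1 ∈ A`. -/
structure IsArensAlgebra {A DA B : Type*} [Monoid A] [Ring B]
    (pA : DA → A → ℝ) (pB : B → DA → ℝ) : Prop where
  mul_def : ∀ F G : B, IsArensProduct pA pB F G (F * G)
  one_def : ∀ f : DA, pB 1 f = pA f 1

section NormedArens

variable (Z : Type*) [NormedRing Z] [NormedAlgebra ℝ Z]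

/-- First step of the Arens construction: `f ⬝ a` for `f ∈ Z'`, `a ∈ Z`:
`(f⬝a)(b) = f(ab)`. -/
def arensDot (f : Z →L[ℝ] ℝ) (a : Z) : Z →L[ℝ] ℝ :=
  f.comp (ContinuousLinearMap.mul ℝ Z a)

/-- `a ↦ f ⬝ a` as a continuous linear map. -/
def arensDotL (f : Z →L[ℝ] ℝ) : Z →L[ℝ] Z →L[ℝ] ℝ :=
  (ContinuousLinearMap.compL ℝ Z Z ℝ f).comp (ContinuousLinearMap.mul ℝ Z)

/-- Second step of the Arens construction: `F ⬝ f` for `F ∈ Z''`, `f ∈ Z'`: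
`(F⬝f)(a) = F(f⬝a)`. -/
def arensFDot (F : (Z →L[ℝ] ℝ) →L[ℝ] ℝ) (f : Z →L[ℝ] ℝ) : Z →L[ℝ] ℝ :=
  F.comp (arensDotL Z f)

/-- `f ↦ f ⬝ ·` as a continuous linear map. -/
def arensDotLL : (Z →L[ℝ] ℝ) →L[ℝ] Z →L[ℝ] Z →L[ℝ] ℝ :=
  ((ContinuousLinearMap.compL ℝ Z (Z →L[ℝ] Z) (Z →L[ℝ] ℝ)).flip
      (ContinuousLinearMap.mul ℝ Z)).comp (ContinuousLinearMap.compL ℝ Z Z ℝ)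

/-- `f ↦ F ⬝ f` as a continuous linear map. -/
def arensFDotL (F : (Z →L[ℝ] ℝ) →L[ℝ] ℝ) : (Z →L[ℝ] ℝ) →L[ℝ] Z →L[ℝ] ℝ :=
  (ContinuousLinearMap.compL ℝ Z (Z →L[ℝ] ℝ) ℝ F).comp (arensDotLL Z)

/-- The *Arens product* on the norm bidual `Z''`: `(F⬝G)(f) = F(G⬝f)`. -/
def arensMul (F G : (Z →L[ℝ] ℝ) →L[ℝ] ℝ) : (Z →L[ℝ] ℝ) →L[ℝ] ℝ :=
  F.comp (arensFDotL Z G)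

/-- The canonical image of `1 ∈ Z` in the bidual `Z''`; it is the unit for the Arens
product. -/
def arensOne : (Z →L[ℝ] ℝ) →L[ℝ] ℝ := ContinuousLinearMap.apply ℝ ℝ (1 : Z)

end NormedArens

section DualOrder

variable {Z : Type*} [Lattice Z] [NormedRing Z] [NormedAlgebra ℝ Z]

/-- Positivity of a functional in `Z'`. -/
def dualNonneg (μ : Z →L[ℝ] ℝ) : Prop := ∀ a : Z, 0 ≤ a → 0 ≤ μ a

/-- The canonical order of the bidual `Z''`. -/
def bidualLe (F G : (Z →L[ℝ] ℝ) →L[ℝ] ℝ) : Prop :=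
  ∀ μ : Z →L[ℝ] ℝ, dualNonneg μ → F μ ≤ G μ

/-- `H = F ⊔ G` in the bidual `Z''`. -/
def IsBidualSup (F G H : (Z →L[ℝ] ℝ) →L[ℝ] ℝ) : Prop :=
  bidualLe F H ∧ bidualLe G H ∧
    ∀ K : (Z →L[ℝ] ℝ) →L[ℝ] ℝ, bidualLe F K → bidualLe G K → bidualLe H K

/-- `s ⊆ Z''` is downward directed with infimum `0`. -/
def BidualDownTo0 (s : Set ((Z →L[ℝ] ℝ) →L[ℝ] ℝ)) : Prop :=
  s.Nonempty ∧ (∀ F ∈ s, ∀ G ∈ s, ∃ H ∈ s, bidualLe H F ∧ bidualLe H G) ∧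
    (∀ F ∈ s, bidualLe 0 F) ∧ ∀ K, (∀ F ∈ s, bidualLe K F) → bidualLe K 0

/-- The Riesz–Kantorovich formula for `|μ|(a)`, `μ ∈ Z'`, `a ∈ Z₊`. -/
def dualAbs (μ : Z →L[ℝ] ℝ) (a : Z) : ℝ := sSup ((fun b => μ b) '' {b : Z | |b| ≤ a})

/-- Disjointness `|μ| ⊓ |ν| = 0` in `Z'`. -/
def DualDisjoint (μ ν : Z →L[ℝ] ℝ) : Prop :=
  ∀ a : Z, 0 ≤ a → ∀ ε : ℝ, 0 < ε →
    ∃ b c : Z, 0 ≤ b ∧ 0 ≤ c ∧ b + c = a ∧ dualAbs μ b + dualAbs ν c < ε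

/-- The Riesz–Kantorovich formula for `|F|(μ)`, `F ∈ Z''`, `μ ∈ Z'₊`. -/
def bidualAbs (F : (Z →L[ℝ] ℝ) →L[ℝ] ℝ) (μ : Z →L[ℝ] ℝ) : ℝ :=
  sSup ((fun ν => F ν) '' {ν : Z →L[ℝ] ℝ | ∀ a : Z, 0 ≤ a → dualAbs ν a ≤ μ a})

/-- Disjointness `|F| ⊓ |G| = 0` in `Z''`. -/
def BidualDisjoint (F G : (Z →L[ℝ] ℝ) →L[ℝ] ℝ) : Prop :=
  ∀ μ : Z →L[ℝ] ℝ, dualNonneg μ → ∀ ε : ℝ, 0 < ε →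
    ∃ μ₁ μ₂ : Z →L[ℝ] ℝ, dualNonneg μ₁ ∧ dualNonneg μ₂ ∧ μ₁ + μ₂ = μ ∧
      bidualAbs F μ₁ + bidualAbs G μ₂ < ε

end DualOrder

/-- A member of the ideal center `Z(J)` of an order ideal `J` of a Riesz space, encoded as a
map defined on the ambient space whose restriction to `J` is the actual operator. -/
def IsCentralOn {D : Type*} [Lattice D] [AddCommGroup D] [Module ℝ D]
    (J : Set D) (S : D → D) : Prop :=
  (∀ f ∈ J, S f ∈ J) ∧ (∀ f ∈ J, ∀ g ∈ J, S (f + g) = S f + S g) ∧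
    (∀ (c : ℝ), ∀ f ∈ J, S (c • f) = c • S f) ∧
    ∃ c : ℝ, ∀ f ∈ J, 0 ≤ f → -(c • f) ≤ S f ∧ S f ≤ c • f

end

section LatticeOrdered

variable {V : Type*} [Lattice V] [AddCommGroup V] [IsOrderedAddMonoid V]

lemma add_inf_eq_zero {a b c : V} (ha : 0 ≤ a) (hb : 0 ≤ b) (hc : 0 ≤ c)
    (hac : a ⊓ c = 0) (hbc : b ⊓ c = 0) : (a + b) ⊓ c = 0 := by
  refine le_antisymm ?_ (le_inf (add_nonneg ha hb) hc)
  have h1 : (a + b) ⊓ c - a ≤ b ⊓ c :=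
    le_inf (by rw [sub_le_iff_le_add']; exact inf_le_left)
      ((sub_le_self _ ha).trans inf_le_right)
  rw [hbc, sub_nonpos] at h1
  exact (le_inf h1 inf_le_right).trans hac.le

lemma inf_eq_zero_of_le {a b c d : V} (ha : 0 ≤ a) (hb : 0 ≤ b) (hac : a ≤ c) (hbd : b ≤ d)
    (h : c ⊓ d = 0) : a ⊓ b = 0 :=
  le_antisymm ((inf_le_inf hac hbd).trans h.le) (le_inf ha hb)

lemma posPart_add_le (a b : V) : (a + b)⁺ ≤ a⁺ + b⁺ :=
  sup_le (add_le_add (le_posPart a) (le_posPart b))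
    (add_nonneg (posPart_nonneg a) (posPart_nonneg b))

lemma posPart_sub_of_inf_eq_zero {a b : V} (h : a ⊓ b = 0) : (a - b)⁺ = a := by
  have := inf_eq_sub_posPart_sub a b
  rw [h] at this
  exact (sub_eq_zero.mp this.symm).symm

variable [Module ℝ V] [PosSMulMono ℝ V]

lemma smul_le_smul_of_le {c d : ℝ} {x : V} (hcd : c ≤ d) (hx : 0 ≤ x) : c • x ≤ d • x := by
  rw [← sub_nonneg, ← sub_smul]
  exact smul_nonneg (sub_nonneg.2 hcd) hx

lemma inf_smul_eq_zero {a b : V} (ha : 0 ≤ a) (hb : 0 ≤ b) (h : a ⊓ b = 0) {t : ℝ}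
    (ht : 0 ≤ t) : a ⊓ t • b = 0 := by
  set s := max t 1 with hs
  have hs1 : (1 : ℝ) ≤ s := le_max_right _ _
  have hs0 : (0 : ℝ) < s := by linarith
  refine le_antisymm ?_ (le_inf ha (smul_nonneg ht hb))
  have h1 : s⁻¹ • (a ⊓ t • b) ≤ a ⊓ b := by
    refine le_inf ?_ ?_
    · calc s⁻¹ • (a ⊓ t • b) ≤ s⁻¹ • a := smul_le_smul_of_nonneg_left inf_le_left (by positivity)
        _ ≤ (1 : ℝ) • a := smul_le_smul_of_le (inv_le_one_of_one_le₀ hs1) ha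
        _ = a := one_smul _ _
    · calc s⁻¹ • (a ⊓ t • b) ≤ s⁻¹ • (s • b) := smul_le_smul_of_nonneg_left
            (inf_le_right.trans (smul_le_smul_of_le (le_max_left _ _) hb)) (by positivity)
        _ = b := inv_smul_smul₀ hs0.ne' b
  rw [h] at h1
  have h2 := smul_le_smul_of_nonneg_left h1 hs0.le
  rwa [smul_inv_smul₀ hs0.ne', smul_zero] at h2

/-- Positive orthomorphisms: positive linear maps which preserve disjointness from a given
positive element. -/
structure IsPosOrtho (T : V → V) : Prop where
  lin : IsLinearMap ℝ T
  nonneg : ∀ x, 0 ≤ x → 0 ≤ T x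
  disj : ∀ x y, 0 ≤ x → 0 ≤ y → x ⊓ y = 0 → T x ⊓ y = 0

omit [PosSMulMono ℝ V] in
lemma monotone_of_nonneg {W : Type*} [AddCommGroup W] [PartialOrder W]
    [IsOrderedAddMonoid W] [Module ℝ W] {T : V → W} (hT : IsLinearMap ℝ T)
    (h : ∀ x, 0 ≤ x → 0 ≤ T x) : Monotone T := fun x y hxy => by
  rw [← sub_nonneg, ← hT.map_sub]
  exact h _ (sub_nonneg.2 hxy)

lemma IsPosOrtho.mono {T : V → V} (hT : IsPosOrtho T) : Monotone T :=
  monotone_of_nonneg hT.lin hT.nonneg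

lemma IsPosOrtho.comp {S T : V → V} (hS : IsPosOrtho S) (hT : IsPosOrtho T) :
    IsPosOrtho fun x => S (T x) where
  lin := ((hS.lin.mk').comp (hT.lin.mk')).isLinear
  nonneg x hx := hS.nonneg _ (hT.nonneg _ hx)
  disj x y hx hy h := hS.disj _ _ (hT.nonneg _ hx) hy (hT.disj _ _ hx hy h)

lemma IsPosOrtho.smul {T : V → V} (hT : IsPosOrtho T) {c : ℝ} (hc : 0 ≤ c) :
    IsPosOrtho fun x => c • T x where
  lin := (c • hT.lin.mk').isLinear
  nonneg x hx := smul_nonneg hc (hT.nonneg _ hx)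
  disj x y hx hy h := by
    rw [inf_comm]
    exact inf_smul_eq_zero hy (hT.nonneg _ hx) (by rw [inf_comm]; exact hT.disj _ _ hx hy h) hc

lemma isPosOrtho_id : IsPosOrtho (fun x : V => x) where
  lin := LinearMap.id.isLinear
  nonneg _ hx := hx
  disj _ _ _ _ h := h

/-- `m T ≤ m² + T²` for a positive orthomorphism `T`. -/
lemma IsPosOrtho.smul_le {T : V → V} (hT : IsPosOrtho T) {m : ℝ} (hm : 0 ≤ m) {z : V}
    (hz : 0 ≤ z) : m • T z ≤ m ^ 2 • z + T (T z) := by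
  set w := T z - m • z with hw
  have hTw : T w = T (T z) - m • T z := by rw [hw, hT.lin.map_sub, hT.lin.map_smul]
  have h1 : m • T z - T (T z) ≤ T w⁻ := by
    have : m • T z - T (T z) = T (-w) := by rw [hT.lin.map_neg, hTw]; abel
    rw [this]
    exact hT.mono (neg_le_negPart w)
  have h2 : m • T z - m ^ 2 • z ≤ m • w⁺ := by
    have : m • T z - m ^ 2 • z = m • w := by rw [hw, smul_sub, smul_smul, sq]
    rw [this]
    exact smul_le_smul_of_nonneg_left (le_posPart w) hm
  have h3 : T w⁻ ⊓ m • w⁺ = 0 := inf_smul_eq_zero (hT.nonneg _ (negPart_nonneg w))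
    (posPart_nonneg w) (hT.disj _ _ (negPart_nonneg w) (posPart_nonneg w)
      (by rw [inf_comm]; exact posPart_inf_negPart_eq_zero w)) hm
  rw [← sub_nonpos, ← h3]
  refine le_inf (le_trans ?_ h1) (le_trans ?_ h2)
  · exact sub_le_sub_left (le_add_of_nonneg_left (smul_nonneg (sq_nonneg m) hz)) _
  · exact sub_le_sub_left (le_add_of_nonneg_right (hT.nonneg _ (hT.nonneg _ hz))) _

/-- If `w ≤ T f` lies in the kernel of a positive orthomorphism `T`, then `w` is
infinitesimal with respect to `f`. -/
lemma IsPosOrtho.smul_le_of_apply_eq_zero {T : V → V} (hT : IsPosOrtho T) {f w : V}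
    (hw : 0 ≤ w) (hTw : T w ≤ 0) (hwf : w ≤ T f) {n : ℝ} (hn : 0 ≤ n) (hf : 0 ≤ f) :
    n • w ≤ f := by
  set q := (f - n • w)⁻ with hq
  have hq0 : 0 ≤ q := negPart_nonneg _
  have hqle : q ≤ n • w := by
    refine sup_le ?_ (smul_nonneg hn hw)
    rw [neg_sub]
    exact sub_le_self _ hf
  have hTw' : T w = 0 := le_antisymm hTw (hT.nonneg _ hw)
  have hTq : T q ≤ 0 := by
    refine (hT.mono hqle).trans ?_
    rw [hT.lin.map_smul, hTw', smul_zero]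
  have h1 : T (f - n • w)⁺ ⊓ q = 0 :=
    hT.disj _ _ (posPart_nonneg _) hq0 (posPart_inf_negPart_eq_zero _)
  have h2 : w ≤ T (f - n • w)⁺ := by
    have : T f = T (f - n • w) := by
      rw [hT.lin.map_sub, hT.lin.map_smul, hTw', smul_zero, sub_zero]
    rw [this] at hwf
    exact hwf.trans (hT.mono (le_posPart _))
  have h3 : q ⊓ w = 0 := by
    rw [inf_comm]
    exact inf_eq_zero_of_le hw hq0 h2 le_rfl h1
  have h4 : q ⊓ n • w = 0 := inf_smul_eq_zero hq0 hw h3 hn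
  rw [inf_eq_left.2 hqle] at h4
  exact sub_nonneg.1 (negPart_eq_zero.1 h4)

end LatticeOrdered

section Commutation

variable {V : Type*} [Lattice V] [AddCommGroup V] [IsOrderedAddMonoid V]

lemma exists_maximal_inf_closed {u : V} (hu : 0 ≤ u) (hu0 : u ≠ 0) :
    ∃ U : Set V, u ∈ U ∧ (∀ w ∈ U, 0 ≤ w) ∧ (∀ w ∈ U, ∀ w' ∈ U, w ⊓ w' ∈ U) ∧ (0 : V) ∉ U ∧
      ∀ y, 0 ≤ y → (∃ w ∈ U, y ⊓ w = 0) ∨ ∃ w ∈ U, w ≤ y := by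
  obtain ⟨U, huU, hU⟩ := zorn_subset_nonempty
    {U : Set V | (∀ w ∈ U, 0 ≤ w) ∧ (∀ w ∈ U, ∀ w' ∈ U, w ⊓ w' ∈ U) ∧ (0 : V) ∉ U} (by
      intro c hc hchain _
      refine ⟨⋃₀ c, ⟨?_, ?_, ?_⟩, fun s hs => Set.subset_sUnion_of_mem hs⟩
      · rintro w ⟨s, hs, hw⟩
        exact (hc hs).1 w hw
      · rintro w ⟨s, hs, hw⟩ w' ⟨s', hs', hw'⟩
        rcases hchain.total hs hs' with h | h
        · exact ⟨s', hs', (hc hs').2.1 _ (h hw) _ hw'⟩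
        · exact ⟨s, hs, (hc hs).2.1 _ hw _ (h hw')⟩
      · rintro ⟨s, hs, h0⟩
        exact (hc hs).2.2 h0) {u} (by
      refine ⟨?_, ?_, ?_⟩
      · rintro w rfl
        exact hu
      · rintro w rfl w' rfl
        simp
      · exact fun h => hu0 (Set.mem_singleton_iff.1 h).symm)
  obtain ⟨⟨hpos, hinf, h0⟩, hmax⟩ := hU
  have huU : u ∈ U := huU rfl
  refine ⟨U, huU, hpos, hinf, h0, fun y hy => ?_⟩
  by_contra! hcon
  obtain ⟨h1, h2⟩ := hcon
  refine h2 (y ⊓ u) (hmax (y := U ∪ (fun w => y ⊓ w) '' U) ⟨?_, ?_, ?_⟩ Set.subset_union_left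
    (Or.inr ⟨u, huU, rfl⟩)) inf_le_left
  · rintro w (hw | ⟨w, hw, rfl⟩)
    · exact hpos w hw
    · exact le_inf hy (hpos w hw)
  · rintro w (hw | ⟨w, hw, rfl⟩) w' (hw' | ⟨w', hw', rfl⟩)
    · exact Or.inl (hinf _ hw _ hw')
    · exact Or.inr ⟨w ⊓ w', hinf _ hw _ hw', inf_left_comm _ _ _⟩
    · exact Or.inr ⟨w ⊓ w', hinf _ hw _ hw', (inf_assoc _ _ _).symm⟩
    · exact Or.inr ⟨w ⊓ w', hinf _ hw _ hw', inf_inf_distrib_left _ _ _⟩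
  · rintro (h | ⟨w, hw, h⟩)
    · exact h0 h
    · exact h1 w hw h

variable [Module ℝ V] [PosSMulMono ℝ V]

/-- A vector which is not negative can be kept out of the negative cone of a total vector
preorder which extends the order and is preserved by all positive orthomorphisms. -/
lemma exists_total_cone {g : V} (hg : ¬ g ≤ 0) :
    ∃ N : Set V, (∀ x ≤ 0, x ∈ N) ∧ (∀ x ∈ N, ∀ y ∈ N, x + y ∈ N) ∧
      (∀ T, IsPosOrtho T → ∀ x ∈ N, T x ∈ N) ∧ (∀ x, x ∈ N ∨ -x ∈ N) ∧ g ∉ N := by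
  obtain ⟨U, hgU, hpos, hinf, h0, hdich⟩ :=
    exists_maximal_inf_closed (posPart_nonneg g) (fun h => hg (posPart_eq_zero.1 h))
  refine ⟨{x | ∃ w ∈ U, x⁺ ⊓ w = 0}, ?_, ?_, ?_, ?_, ?_⟩
  · intro x hx
    exact ⟨g⁺, hgU, by rw [posPart_eq_zero.2 hx]; exact inf_eq_left.2 (posPart_nonneg g)⟩
  · rintro x ⟨w, hw, hxw⟩ y ⟨w', hw', hyw⟩
    have hww := hpos _ (hinf _ hw _ hw')
    refine ⟨w ⊓ w', hinf _ hw _ hw', inf_eq_zero_of_le (posPart_nonneg _) hww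
      (posPart_add_le x y) le_rfl (add_inf_eq_zero (posPart_nonneg _) (posPart_nonneg _) hww ?_ ?_)⟩
    · exact inf_eq_zero_of_le (posPart_nonneg _) hww le_rfl inf_le_left hxw
    · exact inf_eq_zero_of_le (posPart_nonneg _) hww le_rfl inf_le_right hyw
  · rintro T hT x ⟨w, hw, hxw⟩
    refine ⟨w, hw, inf_eq_zero_of_le (posPart_nonneg _) (hpos w hw) ?_ le_rfl
      (hT.disj _ _ (posPart_nonneg x) (hpos w hw) hxw)⟩
    exact sup_le (hT.mono (le_posPart x)) (hT.nonneg _ (posPart_nonneg x))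
  · intro x
    rcases hdich x⁺ (posPart_nonneg x) with h | ⟨w, hw, hwx⟩
    · exact Or.inl h
    · refine Or.inr ⟨w, hw, ?_⟩
      rw [posPart_neg, inf_comm]
      exact inf_eq_zero_of_le (hpos w hw) (negPart_nonneg x) hwx le_rfl
        (posPart_inf_negPart_eq_zero x)
  · rintro ⟨w, hw, h⟩
    exact h0 (h ▸ hinf _ hgU _ hw)

lemma IsPosOrtho.exists_nat_bounds {T : V → V} (hT : IsPosOrtho T) {N : Set V}
    (hneg : ∀ x ≤ 0, x ∈ N) (hadd : ∀ x ∈ N, ∀ y ∈ N, x + y ∈ N) (htot : ∀ x, x ∈ N ∨ -x ∈ N)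
    (hort : ∀ T, IsPosOrtho T → ∀ x ∈ N, T x ∈ N) {n : ℕ} {x : V} (hx : 0 ≤ x)
    (hTx : T x - (n : ℝ) • x ∈ N) :
    ∃ k : ℕ, (k : ℝ) • x - (n : ℝ) • T x ∈ N ∧ (n : ℝ) • T x - ((k : ℝ) + 1) • x ∈ N := by
  classical
  have hn : (0 : ℝ) ≤ n := n.cast_nonneg
  have hP : ∃ j : ℕ, (n : ℝ) • T x - (j : ℝ) • x ∈ N := by
    refine ⟨n ^ 2, ?_⟩
    have := hort _ (isPosOrtho_id.smul hn) _ hTx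
    convert this using 1
    push_cast
    module
  have hspec := Nat.find_spec hP
  rcases hj : Nat.find hP with _ | k
  · rw [hj] at hspec
    refine ⟨0, hneg _ ?_, ?_⟩
    · rw [Nat.cast_zero, zero_smul, zero_sub, neg_nonpos]
      exact smul_nonneg hn (hT.nonneg x hx)
    · have := hadd _ hspec _ (hneg _ (neg_nonpos.2 hx))
      convert this using 1
      push_cast
      module
  · rw [hj] at hspec
    refine ⟨k, ?_, by exact_mod_cast hspec⟩
    have := Nat.find_min hP (m := k) (by omega)
    have h2 := (htot _).resolve_left this
    rwa [neg_sub] at h2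

/-- Over every total preorder preserved by positive orthomorphisms, `S` and `T` act by
comparing with multiples of `x`; this bounds their commutator. -/
lemma IsPosOrtho.commutator_le {S T : V → V} (hS : IsPosOrtho S) (hT : IsPosOrtho T) {x : V}
    (hx : 0 ≤ x) {n : ℕ} (hn : 1 ≤ n) :
    (n : ℝ) • (S (T x) - T (S x)) ≤ x + S x + T x + S (T (T x)) + S (T (S x)) := by
  have hn0 : (0 : ℝ) ≤ n := n.cast_nonneg
  have hn1 : (1 : ℝ) ≤ n := by exact_mod_cast hn
  have hSx := hS.nonneg x hx
  have hTx := hT.nonneg x hx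
  have hTSx := hT.nonneg _ hSx
  have hSTT := hS.nonneg _ (hT.nonneg _ hTx)
  have hSTS := hS.nonneg _ hTSx
  rw [← sub_nonpos]
  by_contra hg
  obtain ⟨N, hneg, hadd, hort, htot, hgN⟩ := exists_total_cone hg
  refine hgN ?_
  have hN : ∀ a ∈ N, ∀ b, b ≤ a → b ∈ N := fun a ha b hb => by
    have := hadd _ ha _ (hneg _ (sub_nonpos.2 hb))
    rwa [add_sub_cancel] at this
  have hnTS : 0 ≤ (n : ℝ) • T (S x) := smul_nonneg hn0 hTSx
  rcases htot (T x - (n : ℝ) • x) with h1 | h1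
  · rcases htot (S x - (n : ℝ) • x) with h2 | h2
    · obtain ⟨k, hk1, hk2⟩ := hT.exists_nat_bounds hneg hadd htot hort hx h1
      obtain ⟨l, hl1, hl2⟩ := hS.exists_nat_bounds hneg hadd htot hort hx h2
      have hk0 : (0 : ℝ) ≤ k := k.cast_nonneg
      have hl0 : (0 : ℝ) ≤ l := l.cast_nonneg
      have e1 := hort _ (hS.smul hn0) _ hk2
      have e2 := hort _ (isPosOrtho_id.smul (by positivity : (0 : ℝ) ≤ (k : ℝ) + 1)) _ hl2
      have e3 := hort _ (hT.smul hn0) _ hl1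
      have e4 := hort _ (isPosOrtho_id.smul hl0) _ hk1
      simp only [hS.lin.map_sub, hS.lin.map_smul, hT.lin.map_sub, hT.lin.map_smul] at e1 e2 e3 e4
      have e5 := hadd _ (hadd _ (hadd _ (hadd _ (hadd _ e1 _ e2) _ e3) _ e4) _ hk1) _ hl1
      have hinv : (0 : ℝ) ≤ (n : ℝ)⁻¹ := by positivity
      have e6 := hort _ (isPosOrtho_id.smul hinv) _ e5
      refine hN _ e6 _ ?_
      have hne : (n : ℝ) ≠ 0 := by linarith
      have h3 : (n : ℝ)⁻¹ • x ≤ (1 : ℝ) • x := smul_le_smul_of_le (inv_le_one_of_one_le₀ hn1) hx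
      have key : (n : ℝ)⁻¹ • ((n : ℝ) • ((n : ℝ) • S (T x) - ((k : ℝ) + 1) • S x)
          + ((k : ℝ) + 1) • ((n : ℝ) • S x - ((l : ℝ) + 1) • x)
          + (n : ℝ) • ((l : ℝ) • T x - (n : ℝ) • T (S x))
          + (l : ℝ) • ((k : ℝ) • x - (n : ℝ) • T x) + ((k : ℝ) • x - (n : ℝ) • T x)
          + ((l : ℝ) • x - (n : ℝ) • S x)) =
          (n : ℝ) • (S (T x) - T (S x)) - S x - T x - (n : ℝ)⁻¹ • x := by
        match_scalars <;> field_simp <;> ring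
      rw [key]
      rw [one_smul] at h3
      rw [← sub_nonneg]
      have : (n : ℝ) • (S (T x) - T (S x)) - S x - T x - (n : ℝ)⁻¹ • x -
          ((n : ℝ) • (S (T x) - T (S x)) - (x + S x + T x + S (T (T x)) + S (T (S x)))) =
          (x - (n : ℝ)⁻¹ • x) + S (T (T x)) + S (T (S x)) := by abel
      rw [this]
      exact add_nonneg (add_nonneg (sub_nonneg.2 h3) hSTT) hSTS
    · refine hN _ (hort _ (hS.comp hT) _ h2) _ ?_
      simp only [hS.lin.map_sub, hS.lin.map_smul, hT.lin.map_sub, hT.lin.map_smul,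
        hS.lin.map_neg, hT.lin.map_neg]
      rw [← sub_nonneg]
      have : -(S (T (S x)) - (n : ℝ) • S (T x)) -
          ((n : ℝ) • (S (T x) - T (S x)) - (x + S x + T x + S (T (T x)) + S (T (S x)))) =
          x + S x + T x + S (T (T x)) + (n : ℝ) • T (S x) := by module
      rw [this]
      exact add_nonneg (add_nonneg (add_nonneg (add_nonneg hx hSx) hTx) hSTT) hnTS
  · refine hN _ (hort _ (hS.comp hT) _ h1) _ ?_
    simp only [hS.lin.map_sub, hS.lin.map_smul, hT.lin.map_sub, hT.lin.map_smul,
      hS.lin.map_neg, hT.lin.map_neg]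
    rw [← sub_nonneg]
    have : -(S (T (T x)) - (n : ℝ) • S (T x)) -
        ((n : ℝ) • (S (T x) - T (S x)) - (x + S x + T x + S (T (T x)) + S (T (S x)))) =
        x + S x + T x + S (T (S x)) + (n : ℝ) • T (S x) := by module
    rw [this]
    exact add_nonneg (add_nonneg (add_nonneg (add_nonneg hx hSx) hTx) hSTS) hnTS

/-- Positive orthomorphisms commute under every positive functional. -/
lemma IsPosOrtho.functional_comm {S T : V → V} (hS : IsPosOrtho S) (hT : IsPosOrtho T) {x : V}
    (hx : 0 ≤ x) {φ : V → ℝ} (hφ : IsLinearMap ℝ φ) (hpos : ∀ y, 0 ≤ y → 0 ≤ φ y) :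
    φ (S (T x)) = φ (T (S x)) := by
  have key : ∀ {S T : V → V}, IsPosOrtho S → IsPosOrtho T → φ (S (T x)) ≤ φ (T (S x)) := by
    intro S T hS hT
    by_contra! h
    obtain ⟨n, hn⟩ := exists_nat_gt
      (φ (x + S x + T x + S (T (T x)) + S (T (S x))) / (φ (S (T x)) - φ (T (S x))))
    rw [div_lt_iff₀ (sub_pos.2 h)] at hn
    have h1 := monotone_of_nonneg hφ hpos (hS.commutator_le hT hx (n := n + 1) (by omega))
    rw [hφ.map_smul, hφ.map_sub, smul_eq_mul] at h1
    push_cast at h1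
    linarith
  exact le_antisymm (key hS hT) (key hT hS)

end Commutation

section Functionals

variable {V : Type*} [Lattice V] [AddCommGroup V] [IsOrderedAddMonoid V]
  [Module ℝ V] [PosSMulMono ℝ V]

/-- A positive additive real function on the positive cone extends to a linear functional. -/
lemma exists_linear_extension {L : V → ℝ} (hpos : ∀ x, 0 ≤ x → 0 ≤ L x)
    (hadd : ∀ x y, 0 ≤ x → 0 ≤ y → L (x + y) = L x + L y) :
    ∃ h : V → ℝ, IsLinearMap ℝ h ∧ ∀ x, 0 ≤ x → h x = L x := by
  have hmono : ∀ x y, 0 ≤ x → x ≤ y → L x ≤ L y := fun x y hx hxy => by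
    have := hadd x (y - x) hx (sub_nonneg.2 hxy)
    rw [add_sub_cancel] at this
    linarith [hpos _ (sub_nonneg.2 hxy)]
  have h0 : L 0 = 0 := by
    have := hadd 0 0 le_rfl le_rfl
    rw [add_zero] at this
    linarith
  have hnat : ∀ (k : ℕ) x, 0 ≤ x → L ((k : ℝ) • x) = k * L x := by
    intro k x hx
    induction k with
    | zero => simp [h0]
    | succ k ih =>
      push_cast
      rw [add_smul, one_smul, hadd _ _ (smul_nonneg k.cast_nonneg hx) hx, ih]
      ring
  have hsmul : ∀ (c : ℝ) x, 0 ≤ c → 0 ≤ x → L (c • x) = c * L x := by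
    intro c x hc hx
    have key : ∀ n : ℕ, |(n : ℝ) * (L (c • x) - c * L x)| ≤ L x := by
      intro n
      have hnc : 0 ≤ (n : ℝ) * c := mul_nonneg n.cast_nonneg hc
      have e : (n : ℝ) * L (c • x) = L (((n : ℝ) * c) • x) := by
        rw [← hnat _ _ (smul_nonneg hc hx), smul_smul]
      have h1 := hmono _ _ (smul_nonneg (Nat.cast_nonneg _) hx)
        (smul_le_smul_of_le (Nat.floor_le hnc) hx)
      have h2 := hmono _ (((⌊(n : ℝ) * c⌋₊ + 1 : ℕ) : ℝ) • x) (smul_nonneg hnc hx)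
        (smul_le_smul_of_le (by push_cast; exact (Nat.lt_floor_add_one _).le) hx)
      rw [hnat _ _ hx] at h1 h2
      push_cast at h2
      have h3 := mul_le_mul_of_nonneg_right (Nat.floor_le hnc) (hpos x hx)
      have h4 := mul_le_mul_of_nonneg_right (Nat.lt_floor_add_one ((n : ℝ) * c)).le (hpos x hx)
      rw [abs_le]
      constructor <;> nlinarith
    by_contra hne
    have habs : 0 < |L (c • x) - c * L x| := abs_pos.2 (sub_ne_zero.2 hne)
    obtain ⟨n, hn⟩ := exists_nat_gt (L x / |L (c • x) - c * L x|)
    rw [div_lt_iff₀ habs] at hn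
    have := key n
    rw [abs_mul, Nat.abs_cast] at this
    linarith
  have hsub : ∀ a b c d : V, 0 ≤ a → 0 ≤ b → 0 ≤ c → 0 ≤ d → a - b = c - d →
      L a - L b = L c - L d := by
    intro a b c d ha hb hc hd h
    have h1 := hadd a d ha hd
    have h2 := hadd c b hc hb
    have : a + d = c + b := by rwa [sub_eq_sub_iff_add_eq_add] at h
    rw [this] at h1
    linarith
  refine ⟨fun x => L x⁺ - L x⁻, ⟨fun x y => ?_, fun c x => ?_⟩, fun x hx => ?_⟩
  · have := hsub (x + y)⁺ (x + y)⁻ (x⁺ + y⁺) (x⁻ + y⁻) (posPart_nonneg _) (negPart_nonneg _)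
      (add_nonneg (posPart_nonneg _) (posPart_nonneg _))
      (add_nonneg (negPart_nonneg _) (negPart_nonneg _))
      (by rw [posPart_sub_negPart, add_sub_add_comm, posPart_sub_negPart, posPart_sub_negPart])
    rw [hadd _ _ (posPart_nonneg _) (posPart_nonneg _),
      hadd _ _ (negPart_nonneg _) (negPart_nonneg _)] at this
    linarith
  · rw [smul_eq_mul]
    rcases le_total 0 c with hc | hc
    · have := hsub (c • x)⁺ (c • x)⁻ (c • x⁺) (c • x⁻) (posPart_nonneg _) (negPart_nonneg _)
        (smul_nonneg hc (posPart_nonneg _)) (smul_nonneg hc (negPart_nonneg _))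
        (by rw [posPart_sub_negPart, ← smul_sub, posPart_sub_negPart])
      rw [hsmul _ _ hc (posPart_nonneg _), hsmul _ _ hc (negPart_nonneg _)] at this
      linarith
    · have hc' : 0 ≤ -c := neg_nonneg.2 hc
      have := hsub (c • x)⁺ (c • x)⁻ ((-c) • x⁻) ((-c) • x⁺) (posPart_nonneg _) (negPart_nonneg _)
        (smul_nonneg hc' (negPart_nonneg _)) (smul_nonneg hc' (posPart_nonneg _))
        (by rw [posPart_sub_negPart, ← smul_sub, neg_smul, ← smul_neg, neg_sub,
              posPart_sub_negPart])
      rw [hsmul _ _ hc' (posPart_nonneg _), hsmul _ _ hc' (negPart_nonneg _)] at this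
      linarith
  · simp only
    rw [posPart_of_nonneg hx, negPart_of_nonneg hx, h0, sub_zero]

/-- Additive families of nonempty sets of nonnegative reals have a linear lower envelope. -/
lemma exists_linear_lower_envelope {A : V → Set ℝ} (hne : ∀ x, 0 ≤ x → (A x).Nonempty)
    (hpos : ∀ x, 0 ≤ x → ∀ r ∈ A x, 0 ≤ r)
    (hadd : ∀ x y, 0 ≤ x → 0 ≤ y → ∀ r ∈ A x, ∀ r' ∈ A y, ∃ t ∈ A (x + y), t ≤ r + r')
    (hsplit : ∀ x y, 0 ≤ x → 0 ≤ y → ∀ t ∈ A (x + y), ∃ r ∈ A x, ∃ r' ∈ A y, r + r' ≤ t) :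
    ∃ h : V → ℝ, IsLinearMap ℝ h ∧ (∀ x, 0 ≤ x → 0 ≤ h x) ∧
      (∀ x, 0 ≤ x → ∀ r ∈ A x, h x ≤ r) ∧
      ∀ x, 0 ≤ x → ∀ ε : ℝ, 0 < ε → ∃ r ∈ A x, r < h x + ε := by
  have hle : ∀ x, 0 ≤ x → ∀ r ∈ A x, sInf (A x) ≤ r := fun x hx r hr =>
    csInf_le ⟨0, fun r hr => hpos x hx r hr⟩ hr
  have hnn : ∀ x, 0 ≤ x → 0 ≤ sInf (A x) := fun x hx => le_csInf (hne x hx) (hpos x hx)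
  obtain ⟨h, hlin, hh⟩ := exists_linear_extension (L := fun x => sInf (A x)) hnn (by
    intro x y hx hy
    refine le_antisymm (le_of_forall_pos_le_add fun ε hε => ?_) ?_
    · obtain ⟨r, hr, hr'⟩ := exists_lt_of_csInf_lt (hne x hx)
        (lt_add_of_pos_right (sInf (A x)) (half_pos hε))
      obtain ⟨s, hs, hs'⟩ := exists_lt_of_csInf_lt (hne y hy)
        (lt_add_of_pos_right (sInf (A y)) (half_pos hε))
      obtain ⟨t, ht, htle⟩ := hadd x y hx hy r hr s hs
      linarith [hle _ (add_nonneg hx hy) t ht]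
    · refine le_csInf (hne _ (add_nonneg hx hy)) fun t ht => ?_
      obtain ⟨r, hr, s, hs, hle'⟩ := hsplit x y hx hy t ht
      linarith [hle x hx r hr, hle y hy s hs])
  refine ⟨h, hlin, fun x hx => ?_, fun x hx r hr => ?_, fun x hx ε hε => ?_⟩
  · rw [hh x hx]
    exact hnn x hx
  · rw [hh x hx]
    exact hle x hx r hr
  · rw [hh x hx]
    exact exists_lt_of_csInf_lt (hne x hx) (lt_add_of_pos_right _ hε)

/-- The Riesz–Kantorovich formula for disjoint positive functionals. -/
lemma exists_decomposition_lt {φ χ : V → ℝ} (hφ : IsLinearMap ℝ φ) (hχ : IsLinearMap ℝ χ)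
    (hφ0 : ∀ x, 0 ≤ x → 0 ≤ φ x) (hχ0 : ∀ x, 0 ≤ x → 0 ≤ χ x)
    (hdisj : ∀ h : V → ℝ, IsLinearMap ℝ h → (∀ x, 0 ≤ x → 0 ≤ h x) →
      (∀ x, 0 ≤ x → h x ≤ φ x) → (∀ x, 0 ≤ x → h x ≤ χ x) → ∀ x, 0 ≤ x → h x ≤ 0)
    {x : V} (hx : 0 ≤ x) {ε : ℝ} (hε : 0 < ε) :
    ∃ y, 0 ≤ y ∧ y ≤ x ∧ φ y + χ (x - y) < ε := by
  obtain ⟨h, hlin, hpos, hle, hlt⟩ := exists_linear_lower_envelope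
    (A := fun x => {r | ∃ y, 0 ≤ y ∧ y ≤ x ∧ r = φ y + χ (x - y)})
    (fun x hx => ⟨_, 0, le_rfl, hx, rfl⟩)
    (by
      rintro x hx _ ⟨y, hy, hyx, rfl⟩
      exact add_nonneg (hφ0 y hy) (hχ0 _ (sub_nonneg.2 hyx)))
    (by
      rintro x y hx hy _ ⟨u, hu, hux, rfl⟩ _ ⟨v, hv, hvy, rfl⟩
      refine ⟨_, ⟨u + v, add_nonneg hu hv, add_le_add hux hvy, rfl⟩, le_of_eq ?_⟩
      rw [add_sub_add_comm, hφ.map_add, hχ.map_add]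
      ring)
    (by
      rintro x y hx hy _ ⟨w, hw, hwxy, rfl⟩
      refine ⟨_, ⟨w ⊓ x, le_inf hw hx, inf_le_right, rfl⟩, _,
        ⟨w - w ⊓ x, sub_nonneg.2 inf_le_left, ?_, rfl⟩, le_of_eq ?_⟩
      · rw [sub_le_comm]
        exact le_inf (sub_le_self _ hy) (sub_le_iff_le_add.2 hwxy)
      · rw [hφ.map_sub, hχ.map_sub, hχ.map_sub, hχ.map_sub, hχ.map_sub, hχ.map_add]
        ring)
  obtain ⟨_, ⟨y, hy, hyx, rfl⟩, hr⟩ := hlt x hx ε hε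
  have h0 := hdisj h hlin hpos
    (fun x hx => by simpa [hχ.map_zero] using hle x hx _ ⟨x, hx, le_rfl, rfl⟩)
    (fun x hx => by simpa [hφ.map_zero] using hle x hx _ ⟨0, le_rfl, hx, rfl⟩) x hx
  exact ⟨y, hy, hyx, by linarith⟩

lemma exists_antitone_decomposition {φ χ : V → ℝ} (hφ : IsLinearMap ℝ φ) (hχ : IsLinearMap ℝ χ)
    (hφ0 : ∀ x, 0 ≤ x → 0 ≤ φ x) (hχ0 : ∀ x, 0 ≤ x → 0 ≤ χ x) {x : V}
    (h : ∀ ε : ℝ, 0 < ε → ∃ y, 0 ≤ y ∧ y ≤ x ∧ φ y + χ (x - y) < ε) {ε : ℝ} (hε : 0 < ε) :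
    ∃ z : ℕ → V, Antitone z ∧ (∀ n, 0 ≤ z n) ∧ (∀ n, z n ≤ x) ∧
      (∀ n, φ (z n) ≤ ε / 2 ^ n) ∧ ∀ n, χ (x - z n) ≤ ε := by
  have hφm := monotone_of_nonneg hφ hφ0
  have hχm := monotone_of_nonneg hχ hχ0
  choose! y hy0 hyx hy using fun n : ℕ => h (ε / 2 ^ (n + 1)) (by positivity)
  let z : ℕ → V := fun n => Nat.rec (y 0) (fun k w => w ⊓ y (k + 1)) n
  have hzs : ∀ n, z (n + 1) = z n ⊓ y (n + 1) := fun n => rfl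
  have hzy : ∀ n, z n ≤ y n := by
    rintro (_ | n)
    · exact le_rfl
    · exact inf_le_right
  have hz0 : ∀ n, 0 ≤ z n := by
    intro n
    induction n with
    | zero => exact hy0 0
    | succ n ih => exact le_inf ih (hy0 _)
  have hhalf : ∀ n : ℕ, ε / 2 ^ n = 2 * (ε / 2 ^ (n + 1)) := fun n => by
    rw [pow_succ]
    field_simp
  have hp : ∀ n : ℕ, 0 < ε / 2 ^ n := fun n => by positivity
  refine ⟨z, antitone_nat_of_succ_le fun n => inf_le_left, hz0,
    fun n => (hzy n).trans (hyx n), fun n => ?_, fun n => ?_⟩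
  · have h1 := hφm (hzy n)
    have h2 := hχ0 _ (sub_nonneg.2 (hyx n))
    linarith [hy n, hhalf n, hp (n + 1)]
  · have key : χ (x - z n) ≤ ε - ε / 2 ^ (n + 1) := by
      induction n with
      | zero =>
        have h1 := hφ0 _ (hy0 0)
        have h2 := hhalf 0
        rw [pow_zero, div_one] at h2
        change χ (x - y 0) ≤ _
        linarith [hy 0]
      | succ n ih =>
        have h1 : x - z (n + 1) ≤ (x - z n) + (x - y (n + 1)) := by
          rw [hzs, sub_le_iff_le_add]
          have : x - z n + (x - y (n + 1)) + z n ⊓ y (n + 1) =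
              x + ((x - z n ⊔ y (n + 1))) := by
            have := inf_add_sup (z n) (y (n + 1))
            rw [← sub_eq_iff_eq_add.2 this.symm]
            abel
          rw [this]
          exact le_add_of_nonneg_right (sub_nonneg.2
            (sup_le ((hzy n).trans (hyx n)) (hyx _)))
        have h2 := hχm h1
        rw [hχ.map_add] at h2
        have h3 := hφ0 _ (hy0 (n + 1))
        linarith [hy (n + 1), hhalf (n + 1)]
    linarith [hp (n + 1)]

/-- If `m r ≤ m² s + t` for all `m > 0` and `s → 0`, then `r` gets arbitrarily small. -/
lemma exists_lt_of_forall_mul_le {r s : ℕ → ℝ} {t ε : ℝ} (hε : 0 < ε)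
    (h : ∀ n, ∀ m : ℝ, 0 < m → m * r n ≤ m ^ 2 * s n + t) (hs : ∀ n, s n ≤ ε / 2 ^ n)
    {δ : ℝ} (hδ : 0 < δ) : ∃ n, r n < δ := by
  set m : ℝ := 2 * (|t| + 1) / δ with hm
  have hm0 : 0 < m := by positivity
  have hmδ : m * δ = 2 * (|t| + 1) := by rw [hm]; field_simp
  obtain ⟨n, hn⟩ := exists_nat_gt (m ^ 2 * ε)
  have h2n : (n : ℝ) < 2 ^ n := by exact_mod_cast Nat.lt_two_pow_self
  refine ⟨n, ?_⟩
  have h1 : m ^ 2 * s n < 1 := by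
    refine (mul_le_mul_of_nonneg_left (hs n) (sq_nonneg m)).trans_lt ?_
    rw [← mul_div_assoc, div_lt_one (by positivity)]
    linarith
  have h2 := h n m hm0
  have h3 : m * r n < m * δ := by
    rw [hmδ]
    linarith [le_abs_self t, abs_nonneg t]
  exact lt_of_mul_lt_mul_left h3 hm0.le

end Functionals

section OrderBounded

variable {V W X : Type*} [Lattice V] [AddCommGroup V] [IsOrderedAddMonoid V]
  [Lattice W] [AddCommGroup W] [IsOrderedAddMonoid W]

lemma isOrdBdd_of_monotone_sub {f g h : V → W} (hg : Monotone g) (hh : Monotone h)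
    (hf : ∀ x, f x = g x - h x) : IsOrdBdd f := fun a b =>
  ⟨g a - h b, g b - h a, fun x hax hxb => by
    rw [hf]
    exact ⟨sub_le_sub (hg hax) (hh hxb), sub_le_sub (hg hxb) (hh hax)⟩⟩

lemma IsOrdBdd.comp [Preorder X] {f : V → W} {g : W → X} (hg : IsOrdBdd g) (hf : IsOrdBdd f) :
    IsOrdBdd fun x => g (f x) := fun a b => by
  obtain ⟨c, d, hcd⟩ := hf a b
  obtain ⟨c', d', hcd'⟩ := hg c d
  exact ⟨c', d', fun x hax hxb => hcd' _ (hcd x hax hxb).1 (hcd x hax hxb).2⟩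

lemma isOrdBdd_of_nonneg [Module ℝ V] {φ : V → ℝ} (hφ : IsLinearMap ℝ φ)
    (hpos : ∀ x, 0 ≤ x → 0 ≤ φ x) : IsOrdBdd φ := fun a b =>
  ⟨φ a, φ b, fun _ hax hxb =>
    ⟨monotone_of_nonneg hφ hpos hax, monotone_of_nonneg hφ hpos hxb⟩⟩

end OrderBounded

section OrderDual

variable {E D : Type*} [Lattice E] [AddCommGroup E] [IsOrderedAddMonoid E]
  [Module ℝ E] [PosSMulMono ℝ E] [Lattice D] [AddCommGroup D] [IsOrderedAddMonoid D]
  [Module ℝ D] [PosSMulMono ℝ D] {p : D → E → ℝ}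

lemma IsOrderDual.nonneg_iff (h : IsOrderDual E D p) {f : D} :
    0 ≤ f ↔ ∀ x, 0 ≤ x → 0 ≤ p f x := by
  rw [h.le_iff]
  simp only [(h.lin_vec _).map_zero]

lemma IsOrderDual.apply_nonneg (h : IsOrderDual E D p) {f : D} (hf : 0 ≤ f) (x : E)
    (hx : 0 ≤ x) : 0 ≤ p f x := h.nonneg_iff.1 hf x hx

lemma IsOrderDual.eq_of_nonneg (h : IsOrderDual E D p) {x y : E}
    (hxy : ∀ f : D, 0 ≤ f → p f x = p f y) (f : D) : p f x = p f y := by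
  rw [← posPart_sub_negPart f, (h.lin_vec x).map_sub, (h.lin_vec y).map_sub,
    hxy _ (posPart_nonneg f), hxy _ (negPart_nonneg f)]

lemma IsOrderDual.archimedean (h : IsOrderDual E D p) {f w : D}
    (hw : ∀ n : ℕ, (n : ℝ) • w ≤ f) : w ≤ 0 := by
  rw [h.le_iff]
  intro x hx
  rw [(h.lin_vec x).map_zero]
  by_contra! hwx
  obtain ⟨n, hn⟩ := exists_nat_gt (p f x / p w x)
  rw [div_lt_iff₀ hwx] at hn
  have := (h.le_iff _ _).1 (hw n) x hx
  rw [(h.lin_vec x).map_smul, smul_eq_mul] at this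
  linarith

lemma IsOrderDual.inf_apply_le (h : IsOrderDual E D p) (f g : D) {x y : E} (hy : 0 ≤ y)
    (hyx : y ≤ x) : p (f ⊓ g) x ≤ p f y + p g (x - y) := by
  have h1 := (h.le_iff _ _).1 (inf_le_left : f ⊓ g ≤ f) y hy
  have h2 := (h.le_iff _ _).1 (inf_le_right : f ⊓ g ≤ g) (x - y) (sub_nonneg.2 hyx)
  rw [(h.lin_fun _).map_sub] at h2
  linarith

lemma IsOrderDual.exists_decomposition (h : IsOrderDual E D p) {f g : D} (hf : 0 ≤ f)
    (hg : 0 ≤ g) (hfg : f ⊓ g = 0) {x : E} (hx : 0 ≤ x) {ε : ℝ} (hε : 0 < ε) :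
    ∃ y, 0 ≤ y ∧ y ≤ x ∧ p f y + p g (x - y) < ε := by
  refine exists_decomposition_lt (h.lin_fun f) (h.lin_fun g) (h.apply_nonneg hf)
    (h.apply_nonneg hg) (fun φ hφ hφ0 hφf hφg => ?_) hx hε
  obtain ⟨k, hk⟩ := h.surj φ hφ (isOrdBdd_of_nonneg hφ hφ0)
  have hkfg : k ≤ 0 := by
    rw [← hfg]
    refine le_inf ((h.le_iff _ _).2 ?_) ((h.le_iff _ _).2 ?_)
    · simpa only [hk] using hφf
    · simpa only [hk] using hφg
  intro x hx
  have := (h.le_iff _ _).1 hkfg x hx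
  rwa [hk, (h.lin_vec x).map_zero] at this

end OrderDual

section OrderContinuousDual

variable {X B : Type*} [Lattice X] [AddCommGroup X] [IsOrderedAddMonoid X]
  [Module ℝ X] [PosSMulMono ℝ X] [Lattice B] [AddCommGroup B] [IsOrderedAddMonoid B]
  [Module ℝ B] [PosSMulMono ℝ B] {p : B → X → ℝ}

lemma IsOrderContinuousDual.nonneg_iff (h : IsOrderContinuousDual X B p) {F : B} :
    0 ≤ F ↔ ∀ x, 0 ≤ x → 0 ≤ p F x := by
  rw [h.le_iff]
  simp only [(h.lin_vec _).map_zero]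

lemma IsOrderContinuousDual.apply_nonneg (h : IsOrderContinuousDual X B p) {F : B} (hF : 0 ≤ F)
    (x : X) (hx : 0 ≤ x) : 0 ≤ p F x := h.nonneg_iff.1 hF x hx

/-- A positive functional dominated by an order continuous one is order continuous. -/
lemma IsOrderContinuousDual.surj_of_le (h : IsOrderContinuousDual X B p) {φ : X → ℝ}
    (hφ : IsLinearMap ℝ φ) (hφ0 : ∀ x, 0 ≤ x → 0 ≤ φ x) {F : B}
    (hF : ∀ x, 0 ≤ x → φ x ≤ p F x) : ∃ G : B, ∀ x, p G x = φ x := by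
  refine h.surj φ hφ (isOrdBdd_of_nonneg hφ hφ0) fun s hs hdir hglb ε hε => ?_
  obtain ⟨x, hx, hlt⟩ := h.cont F s hs hdir hglb ε hε
  refine ⟨x, hx, fun y hy hyx => ?_⟩
  have hy0 := hglb.1 hy
  rw [abs_of_nonneg (hφ0 y hy0)]
  exact (hF y hy0).trans_lt ((le_abs_self _).trans_lt (hlt y hy hyx))

lemma IsOrderContinuousDual.exists_decomposition (h : IsOrderContinuousDual X B p) {F G : B}
    (hF : 0 ≤ F) (hG : 0 ≤ G) (hFG : F ⊓ G = 0) {x : X} (hx : 0 ≤ x) {ε : ℝ} (hε : 0 < ε) :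
    ∃ y, 0 ≤ y ∧ y ≤ x ∧ p F y + p G (x - y) < ε := by
  refine exists_decomposition_lt (h.lin_fun F) (h.lin_fun G) (h.apply_nonneg hF)
    (h.apply_nonneg hG) (fun φ hφ hφ0 hφf hφg => ?_) hx hε
  obtain ⟨k, hk⟩ := h.surj_of_le hφ hφ0 hφf
  have hkfg : k ≤ 0 := by
    rw [← hFG]
    refine le_inf ((h.le_iff _ _).2 ?_) ((h.le_iff _ _).2 ?_)
    · simpa only [hk] using hφf
    · simpa only [hk] using hφg
  intro x hx
  have := (h.le_iff _ _).1 hkfg x hx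
  rwa [hk, (h.lin_vec x).map_zero] at this

/-- A downward directed set in the order continuous dual decreases to `0` pointwise. -/
lemma IsOrderContinuousDual.exists_apply_lt_of_isGLB (h : IsOrderContinuousDual X B p)
    {s : Set B} (hs : s.Nonempty) (hdir : DirectedOn (· ≥ ·) s) (hglb : IsGLB s 0) {x : X}
    (hx : 0 ≤ x) {ε : ℝ} (hε : 0 < ε) : ∃ F ∈ s, p F x < ε := by
  obtain ⟨φ, hφ, hφ0, hle, hlt⟩ := exists_linear_lower_envelope
    (A := fun x => {r | ∃ F ∈ s, r = p F x})
    (fun x _ => ⟨_, hs.some, hs.some_mem, rfl⟩)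
    (by
      rintro x hx _ ⟨F, hF, rfl⟩
      exact h.apply_nonneg (hglb.1 hF) x hx)
    (by
      rintro x y hx hy _ ⟨F, hF, rfl⟩ _ ⟨G, hG, rfl⟩
      obtain ⟨H, hH, hHF, hHG⟩ := hdir F hF G hG
      refine ⟨_, ⟨H, hH, rfl⟩, ?_⟩
      rw [(h.lin_fun H).map_add]
      exact add_le_add ((h.le_iff _ _).1 hHF x hx) ((h.le_iff _ _).1 hHG y hy))
    (by
      rintro x y hx hy _ ⟨F, hF, rfl⟩
      exact ⟨_, ⟨F, hF, rfl⟩, _, ⟨F, hF, rfl⟩, ((h.lin_fun F).map_add x y).ge⟩)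
  obtain ⟨F₀, hF₀⟩ := hs
  obtain ⟨L, hL⟩ := h.surj_of_le hφ hφ0 (F := F₀) fun x hx => hle x hx _ ⟨F₀, hF₀, rfl⟩
  have hL0 : L ≤ 0 := hglb.2 fun F hF => (h.le_iff _ _).2 fun x hx => by
    rw [hL]
    exact hle x hx _ ⟨F, hF, rfl⟩
  have hφx := (h.le_iff _ _).1 hL0 x hx
  rw [hL, (h.lin_vec x).map_zero] at hφx
  obtain ⟨_, ⟨F, hF, rfl⟩, hlt⟩ := hlt x hx ε hε
  exact ⟨F, hF, by linarith⟩

/-- Order continuity along a decreasing sequence which converges to `0` pointwise. -/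
lemma IsOrderContinuousDual.exists_apply_lt_of_antitone {A : Type*} [Lattice A]
    [AddCommGroup A] [IsOrderedAddMonoid A] [Module ℝ A] {q : X → A → ℝ}
    (hq : IsOrderDual A X q) (h : IsOrderContinuousDual X B p) (F : B) {ζ : ℕ → X}
    (hanti : Antitone ζ) (h0 : ∀ n, 0 ≤ ζ n)
    (hpt : ∀ a, 0 ≤ a → ∀ δ : ℝ, 0 < δ → ∃ n, q (ζ n) a < δ) {ε : ℝ} (hε : 0 < ε) :
    ∃ n, p F (ζ n) < ε := by
  obtain ⟨_, ⟨n, rfl⟩, hn⟩ := h.cont F (Set.range ζ) (Set.range_nonempty ζ) (by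
      rintro _ ⟨m, rfl⟩ _ ⟨n, rfl⟩
      exact ⟨_, ⟨max m n, rfl⟩, hanti (le_max_left _ _), hanti (le_max_right _ _)⟩) (by
      refine ⟨?_, fun θ hθ => (hq.le_iff _ _).2 fun a ha => ?_⟩
      · rintro _ ⟨n, rfl⟩
        exact h0 n
      · rw [(hq.lin_vec a).map_zero]
        refine le_of_forall_pos_le_add fun δ hδ => ?_
        obtain ⟨n, hn⟩ := hpt a ha δ hδ
        have := (hq.le_iff _ _).1 (hθ ⟨n, rfl⟩) a ha
        linarith) ε hε
  exact ⟨n, (le_abs_self _).trans_lt (hn _ ⟨n, rfl⟩ le_rfl)⟩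

end OrderContinuousDual

section Orthomorphisms

variable {E O : Type*} [Lattice E] [AddCommGroup E] [IsOrderedAddMonoid E]
  [Module ℝ E] [PosSMulMono ℝ E] [Lattice O] [Ring O] [IsOrderedAddMonoid O]
  [Module ℝ O] [PosSMulMono ℝ O] {ρ : O → E → E}

lemma IsOrthAlg.nonneg_iff (h : IsOrthAlg E O ρ) {a : O} :
    0 ≤ a ↔ ∀ x, 0 ≤ x → 0 ≤ ρ a x := by
  rw [h.le_iff]
  simp only [(h.lin_vec _).map_zero]

lemma IsOrthAlg.isPosOrtho (h : IsOrthAlg E O ρ) {a : O} (ha : 0 ≤ a) : IsPosOrtho (ρ a) where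
  lin := (h.ortho a).1
  nonneg := h.nonneg_iff.1 ha
  disj x y hx hy hxy := by
    have := (h.ortho a).2.2 x y (by rwa [abs_of_nonneg hx, abs_of_nonneg hy])
    rwa [abs_of_nonneg hy, abs_of_nonneg (h.nonneg_iff.1 ha x hx)] at this

lemma IsOrthAlg.isLinearMap_mul (h : IsOrthAlg E O ρ) (a : O) :
    IsLinearMap ℝ fun b => a * b where
  map_add b c := mul_add a b c
  map_smul c b := h.inj _ _ fun x => by
    rw [h.map_mul, (h.lin_vec x).map_smul, (h.lin_vec x).map_smul, h.map_mul,
      (h.ortho a).1.map_smul]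

lemma IsOrthAlg.mul_nonneg (h : IsOrthAlg E O ρ) {a b : O} (ha : 0 ≤ a) (hb : 0 ≤ b) :
    0 ≤ a * b := h.nonneg_iff.2 fun x hx => by
  rw [h.map_mul]
  exact h.nonneg_iff.1 ha _ (h.nonneg_iff.1 hb x hx)

lemma IsOrthAlg.one_nonneg (h : IsOrthAlg E O ρ) : (0 : O) ≤ 1 := h.nonneg_iff.2 fun x hx => by
  rwa [h.map_one]

lemma IsOrthAlg.smul_mul_le (h : IsOrthAlg E O ρ) {a b : O} (ha : 0 ≤ a) (hb : 0 ≤ b) {m : ℝ}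
    (hm : 0 ≤ m) : m • (a * b) ≤ m ^ 2 • b + a * a * b := (h.le_iff _ _).2 fun x hx => by
  rw [(h.lin_vec x).map_add, (h.lin_vec x).map_smul, (h.lin_vec x).map_smul, mul_assoc,
    h.map_mul, h.map_mul, h.map_mul]
  exact (h.isPosOrtho ha).smul_le hm (h.nonneg_iff.1 hb x hx)

variable {D : Type*} [Lattice D] [AddCommGroup D] [IsOrderedAddMonoid D]
  [Module ℝ D] [PosSMulMono ℝ D] {pE : D → E → ℝ}

/-- Orthomorphisms commute, as seen by order bounded functionals. -/
lemma IsOrthAlg.apply_comm (h : IsOrthAlg E O ρ) (hD : IsOrderDual E D pE) (f : D) (a b : O)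
    (x : E) : pE f (ρ a (ρ b x)) = pE f (ρ b (ρ a x)) := by
  have key : ∀ a b : O, 0 ≤ a → 0 ≤ b → ∀ x, 0 ≤ x → pE f (ρ a (ρ b x)) = pE f (ρ b (ρ a x)) :=
    fun a b ha hb x hx => hD.eq_of_nonneg (fun f hf => (h.isPosOrtho ha).functional_comm
      (h.isPosOrtho hb) hx (hD.lin_fun f) (hD.apply_nonneg hf)) f
  have hx : ∀ a b : O, 0 ≤ a → 0 ≤ b → pE f (ρ a (ρ b x)) = pE f (ρ b (ρ a x)) := by
    intro a b ha hb
    have h1 := key a b ha hb _ (posPart_nonneg x)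
    have h2 := key a b ha hb _ (negPart_nonneg x)
    rw [← posPart_sub_negPart x, (h.ortho b).1.map_sub, (h.ortho a).1.map_sub,
      (h.ortho a).1.map_sub, (h.ortho b).1.map_sub, (hD.lin_fun f).map_sub,
      (hD.lin_fun f).map_sub, h1, h2]
  have hb : ∀ a : O, 0 ≤ a → pE f (ρ a (ρ b x)) = pE f (ρ b (ρ a x)) := by
    intro a ha
    have h1 := hx a _ ha (posPart_nonneg b)
    have h2 := hx a _ ha (negPart_nonneg b)
    rw [← posPart_sub_negPart b, (h.lin_vec _).map_sub, (h.lin_vec _).map_sub,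
      (h.ortho a).1.map_sub, (hD.lin_fun f).map_sub, (hD.lin_fun f).map_sub, h1, h2]
  have h1 := hb _ (posPart_nonneg a)
  have h2 := hb _ (negPart_nonneg a)
  rw [← posPart_sub_negPart a, (h.lin_vec _).map_sub, (h.lin_vec _).map_sub,
    (h.ortho b).1.map_sub, (hD.lin_fun f).map_sub, (hD.lin_fun f).map_sub, h1, h2]

variable {DO : Type*} [Lattice DO] [AddCommGroup DO] [IsOrderedAddMonoid DO]
  [Module ℝ DO] [PosSMulMono ℝ DO] {pO : DO → O → ℝ}

/-- Existence of the functionals `π ↦ f (π x)` in the order dual of `Orth(E)`. -/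
lemma IsOrthAlg.exists_orbit_functional (h : IsOrthAlg E O ρ) (hD : IsOrderDual E D pE)
    (hDO : IsOrderDual O DO pO) :
    ∃ ψ : E → D → DO, ∀ x f π, pO (ψ x f) π = pE f (ρ π x) := by
  have : ∀ x f, ∃ θ : DO, ∀ π, pO θ π = pE f (ρ π x) := fun x f => by
    refine hDO.surj (fun π => pE f (ρ π x))
      ((hD.lin_fun f).mk'.comp (h.lin_vec x).mk').isLinear ((hD.bdd f).comp ?_)
    refine isOrdBdd_of_monotone_sub (g := fun π => ρ π x⁺) (h := fun π => ρ π x⁻)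
      (fun a b hab => (h.le_iff _ _).1 hab _ (posPart_nonneg x))
      (fun a b hab => (h.le_iff _ _).1 hab _ (negPart_nonneg x)) fun π => ?_
    rw [← (h.ortho π).1.map_sub, posPart_sub_negPart]
  choose ψ hψ using this
  exact ⟨ψ, hψ⟩

/-- Existence of the functionals `θ ⬝ a : b ↦ θ (a b)`. -/
lemma IsOrthAlg.exists_dot (h : IsOrthAlg E O ρ) (hDO : IsOrderDual O DO pO) :
    ∃ dot : DO → O → DO, ∀ θ a b, pO (dot θ a) b = pO θ (a * b) := by
  have : ∀ θ a, ∃ η : DO, ∀ b, pO η b = pO θ (a * b) := fun θ a => by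
    refine hDO.surj (fun b => pO θ (a * b))
      ((hDO.lin_fun θ).mk'.comp (h.isLinearMap_mul a).mk').isLinear ((hDO.bdd θ).comp ?_)
    refine isOrdBdd_of_monotone_sub (g := fun b => a⁺ * b) (h := fun b => a⁻ * b)
      (monotone_of_nonneg (h.isLinearMap_mul _) fun b hb => h.mul_nonneg (posPart_nonneg a) hb)
      (monotone_of_nonneg (h.isLinearMap_mul _) fun b hb => h.mul_nonneg (negPart_nonneg a) hb)
      fun b => ?_
    rw [← sub_mul, posPart_sub_negPart]
  choose dot hdot using this
  exact ⟨dot, hdot⟩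

variable {BO : Type*} [Lattice BO] [AddCommGroup BO] [IsOrderedAddMonoid BO]
  [Module ℝ BO] [PosSMulMono ℝ BO] {pB : BO → DO → ℝ}

section Dot

variable {dot : DO → O → DO}

omit [IsOrderedAddMonoid E] [PosSMulMono ℝ E] [PosSMulMono ℝ O] [PosSMulMono ℝ DO] in
lemma IsOrthAlg.isLinearMap_dot (h : IsOrthAlg E O ρ) (hDO : IsOrderDual O DO pO)
    (hdot : ∀ θ a b, pO (dot θ a) b = pO θ (a * b)) (θ : DO) :
    IsLinearMap ℝ (dot θ) where
  map_add a b := hDO.inj _ _ fun c => by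
    rw [(hDO.lin_vec c).map_add, hdot, hdot, hdot, add_mul, (hDO.lin_fun θ).map_add]
  map_smul r a := hDO.inj _ _ fun c => by
    have : r • a * c = r • (a * c) := h.inj _ _ fun x => by
      rw [h.map_mul, (h.lin_vec _).map_smul, (h.lin_vec _).map_smul, h.map_mul]
    rw [(hDO.lin_vec c).map_smul, hdot, hdot, this, (hDO.lin_fun θ).map_smul]

lemma isLinearMap_dot_left (hDO : IsOrderDual O DO pO)
    (hdot : ∀ θ a b, pO (dot θ a) b = pO θ (a * b)) (a : O) :
    IsLinearMap ℝ fun θ => dot θ a where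
  map_add θ η := hDO.inj _ _ fun c => by
    rw [(hDO.lin_vec c).map_add, hdot, hdot, hdot, (hDO.lin_vec _).map_add]
  map_smul r θ := hDO.inj _ _ fun c => by
    rw [(hDO.lin_vec c).map_smul, hdot, hdot, (hDO.lin_vec _).map_smul]

lemma IsOrthAlg.dot_nonneg (h : IsOrthAlg E O ρ) (hDO : IsOrderDual O DO pO)
    (hdot : ∀ θ a b, pO (dot θ a) b = pO θ (a * b)) {θ : DO} (hθ : 0 ≤ θ) {a : O}
    (ha : 0 ≤ a) : 0 ≤ dot θ a := hDO.nonneg_iff.2 fun b hb => by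
  rw [hdot]
  exact hDO.apply_nonneg hθ _ (h.mul_nonneg ha hb)

/-- Existence of the functionals `G ⬝ θ : a ↦ G (θ ⬝ a)`. -/
lemma IsOrthAlg.exists_bidual_dot (h : IsOrthAlg E O ρ) (hDO : IsOrderDual O DO pO)
    (hBO : IsOrderContinuousDual DO BO pB) (hdot : ∀ θ a b, pO (dot θ a) b = pO θ (a * b))
    (G : BO) : ∃ S : DO → DO, ∀ θ a, pO (S θ) a = pB G (dot θ a) := by
  have : ∀ θ, ∃ η : DO, ∀ a, pO η a = pB G (dot θ a) := fun θ => by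
    refine hDO.surj (fun a => pB G (dot θ a))
      ((hBO.lin_fun G).mk'.comp (h.isLinearMap_dot hDO hdot θ).mk').isLinear
      ((hBO.bdd G).comp ?_)
    refine isOrdBdd_of_monotone_sub (g := fun a => dot θ⁺ a) (h := fun a => dot θ⁻ a)
      (monotone_of_nonneg (h.isLinearMap_dot hDO hdot _) fun a ha =>
        h.dot_nonneg hDO hdot (posPart_nonneg θ) ha)
      (monotone_of_nonneg (h.isLinearMap_dot hDO hdot _) fun a ha =>
        h.dot_nonneg hDO hdot (negPart_nonneg θ) ha)
      fun a => ?_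
    rw [← (isLinearMap_dot_left hDO hdot a).map_sub, posPart_sub_negPart]
  choose S hS using this
  exact ⟨S, hS⟩

/-- Disjoint positive elements of the bidual have zero Arens product, when the right factor
is dominated by the unit. -/
lemma IsOrthAlg.apply_bidual_dot_nonpos (h : IsOrthAlg E O ρ) (hDO : IsOrderDual O DO pO)
    (hBO : IsOrderContinuousDual DO BO pB) (hdot : ∀ θ a b, pO (dot θ a) b = pO θ (a * b))
    {F G : BO} (hF : 0 ≤ F) (hG : 0 ≤ G) (hFG : F ⊓ G = 0)
    (hG1 : ∀ θ, 0 ≤ θ → pB G θ ≤ pO θ 1) {θ η : DO} (hθ : 0 ≤ θ)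
    (hη : ∀ a, pO η a = pB G (dot θ a)) : pB F η ≤ 0 := by
  obtain ⟨S, hS⟩ := h.exists_bidual_dot hDO hBO hdot G
  have hSlin : IsLinearMap ℝ S :=
    { map_add := fun θ η => hDO.inj _ _ fun a => by
        rw [(hDO.lin_vec a).map_add, hS, hS, hS, (isLinearMap_dot_left hDO hdot a).map_add,
          (hBO.lin_fun G).map_add]
      map_smul := fun r θ => hDO.inj _ _ fun a => by
        rw [(hDO.lin_vec a).map_smul, hS, hS, (isLinearMap_dot_left hDO hdot a).map_smul,
          (hBO.lin_fun G).map_smul] }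
  have hS0 : ∀ θ, 0 ≤ θ → 0 ≤ S θ := fun θ hθ => hDO.nonneg_iff.2 fun a ha => by
    rw [hS]
    exact hBO.apply_nonneg hG _ (h.dot_nonneg hDO hdot hθ ha)
  have hSmono := monotone_of_nonneg hSlin hS0
  have hSle : ∀ θ, 0 ≤ θ → S θ ≤ θ := fun θ hθ => (hDO.le_iff _ _).2 fun a ha => by
    rw [hS]
    refine (hG1 _ (h.dot_nonneg hDO hdot hθ ha)).trans_eq ?_
    rw [hdot, mul_one]
  have hFmono := monotone_of_nonneg (hBO.lin_fun F) (hBO.apply_nonneg hF)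
  have hGmono := monotone_of_nonneg (hBO.lin_fun G) (hBO.apply_nonneg hG)
  have hηS : η = S θ := hDO.inj _ _ fun a => by rw [hη, hS]
  refine le_of_forall_pos_le_add fun ε hε => ?_
  obtain ⟨z, hanti, hz0, hzθ, hGz, hFz⟩ := exists_antitone_decomposition (hBO.lin_fun G)
    (hBO.lin_fun F) (hBO.apply_nonneg hG) (hBO.apply_nonneg hF)
    (fun ε hε => hBO.exists_decomposition hG hF (by rwa [inf_comm]) hθ hε) (half_pos hε)
  obtain ⟨n, hn⟩ := hBO.exists_apply_lt_of_antitone hDO F (ζ := fun n => S (z n))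
    (fun m n hmn => hSmono (hanti hmn)) (fun n => hS0 _ (hz0 n)) (fun a ha δ hδ => by
      refine exists_lt_of_forall_mul_le (t := pB G (dot θ (a * a))) (half_pos hε)
        (fun n m hm => ?_) hGz hδ
      have h1 : m • dot (z n) a ≤ m ^ 2 • z n + dot θ (a * a) :=
        (hDO.le_iff _ _).2 fun b hb => by
          have h2 := monotone_of_nonneg (hDO.lin_fun (z n)) (hDO.apply_nonneg (hz0 n))
            (h.smul_mul_le ha hb hm.le)
          rw [(hDO.lin_fun _).map_add, (hDO.lin_fun _).map_smul, (hDO.lin_fun _).map_smul] at h2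
          have h3 := (hDO.le_iff _ _).1 (hzθ n) _ (h.mul_nonneg (h.mul_nonneg ha ha) hb)
          rw [(hDO.lin_vec b).map_add, (hDO.lin_vec b).map_smul, (hDO.lin_vec b).map_smul,
            hdot, hdot]
          exact h2.trans (add_le_add_right h3 _)
      have h4 := hGmono h1
      rwa [(hBO.lin_fun G).map_add, (hBO.lin_fun G).map_smul, (hBO.lin_fun G).map_smul,
        ← hS] at h4) (half_pos hε)
  have h1 : pB F (S (θ - z n)) ≤ ε / 2 :=
    (hFmono (hSle _ (sub_nonneg.2 (hzθ n)))).trans (hFz n)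
  have h2 : η = S (z n) + S (θ - z n) := by rw [← hSlin.map_add, add_sub_cancel, hηS]
  rw [h2, (hBO.lin_fun F).map_add]
  linarith

end Dot

end Orthomorphisms

section ArensHom

variable {E D O DO BO : Type*}
  [Lattice E] [AddCommGroup E] [IsOrderedAddMonoid E] [Module ℝ E] [PosSMulMono ℝ E]
  [Lattice D] [AddCommGroup D] [IsOrderedAddMonoid D] [Module ℝ D] [PosSMulMono ℝ D]
  [Lattice O] [Ring O] [IsOrderedAddMonoid O] [Module ℝ O] [PosSMulMono ℝ O]
  [Lattice DO] [AddCommGroup DO] [IsOrderedAddMonoid DO] [Module ℝ DO] [PosSMulMono ℝ DO]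
  [Lattice BO] [Ring BO] [IsOrderedAddMonoid BO] [Module ℝ BO] [PosSMulMono ℝ BO]
  {pE : D → E → ℝ} {ρ : O → E → E} {pO : DO → O → ℝ} {pB : BO → DO → ℝ}
  {ψ : E → D → DO} {γ : BO → D → D}

lemma isLinearMap_orbit_functional (hD : IsOrderDual E D pE) (hDO : IsOrderDual O DO pO)
    (hψ : ∀ x f π, pO (ψ x f) π = pE f (ρ π x)) (x : E) : IsLinearMap ℝ (ψ x) where
  map_add f g := hDO.inj _ _ fun π => by
    rw [(hDO.lin_vec π).map_add, hψ, hψ, hψ, (hD.lin_vec _).map_add]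
  map_smul c f := hDO.inj _ _ fun π => by
    rw [(hDO.lin_vec π).map_smul, hψ, hψ, (hD.lin_vec _).map_smul]

lemma isLinearMap_orbit_vector (hD : IsOrderDual E D pE) (hO : IsOrthAlg E O ρ)
    (hDO : IsOrderDual O DO pO) (hψ : ∀ x f π, pO (ψ x f) π = pE f (ρ π x)) (f : D) :
    IsLinearMap ℝ fun x => ψ x f where
  map_add x y := hDO.inj _ _ fun π => by
    rw [(hDO.lin_vec π).map_add, hψ, hψ, hψ, (hO.ortho π).1.map_add, (hD.lin_fun f).map_add]
  map_smul c x := hDO.inj _ _ fun π => by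
    rw [(hDO.lin_vec π).map_smul, hψ, hψ, (hO.ortho π).1.map_smul, (hD.lin_fun f).map_smul]

lemma orbit_functional_nonneg (hD : IsOrderDual E D pE) (hO : IsOrthAlg E O ρ)
    (hDO : IsOrderDual O DO pO) (hψ : ∀ x f π, pO (ψ x f) π = pE f (ρ π x)) {x : E} (hx : 0 ≤ x)
    {f : D} (hf : 0 ≤ f) : 0 ≤ ψ x f := hDO.nonneg_iff.2 fun π hπ => by
  rw [hψ]
  exact hD.apply_nonneg hf _ (hO.nonneg_iff.1 hπ x hx)

lemma isLinearMap_arensHom (hD : IsOrderDual E D pE) (hDO : IsOrderDual O DO pO)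
    (hBO : IsOrderContinuousDual DO BO pB) (hψ : ∀ x f π, pO (ψ x f) π = pE f (ρ π x))
    (hγ : ∀ F f x, pE (γ F f) x = pB F (ψ x f)) (F : BO) : IsLinearMap ℝ (γ F) where
  map_add f g := hD.inj _ _ fun x => by
    rw [(hD.lin_vec x).map_add, hγ, hγ, hγ, (isLinearMap_orbit_functional hD hDO hψ x).map_add,
      (hBO.lin_fun F).map_add]
  map_smul c f := hD.inj _ _ fun x => by
    rw [(hD.lin_vec x).map_smul, hγ, hγ, (isLinearMap_orbit_functional hD hDO hψ x).map_smul,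
      (hBO.lin_fun F).map_smul]

lemma isLinearMap_arensHom_left (hD : IsOrderDual E D pE) (hBO : IsOrderContinuousDual DO BO pB)
    (hγ : ∀ F f x, pE (γ F f) x = pB F (ψ x f)) (f : D) : IsLinearMap ℝ fun F => γ F f where
  map_add F G := hD.inj _ _ fun x => by
    rw [(hD.lin_vec x).map_add, hγ, hγ, hγ, (hBO.lin_vec _).map_add]
  map_smul c F := hD.inj _ _ fun x => by
    rw [(hD.lin_vec x).map_smul, hγ, hγ, (hBO.lin_vec _).map_smul]

lemma isPosOrtho_arensHom (hD : IsOrderDual E D pE) (hO : IsOrthAlg E O ρ)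
    (hDO : IsOrderDual O DO pO) (hBO : IsOrderContinuousDual DO BO pB)
    (hψ : ∀ x f π, pO (ψ x f) π = pE f (ρ π x))
    (hγ : ∀ F f x, pE (γ F f) x = pB F (ψ x f)) {F : BO} (hF : 0 ≤ F) : IsPosOrtho (γ F) where
  lin := isLinearMap_arensHom hD hDO hBO hψ hγ F
  nonneg f hf := hD.nonneg_iff.2 fun x hx => by
    rw [hγ]
    exact hBO.apply_nonneg hF _ (orbit_functional_nonneg hD hO hDO hψ hx hf)
  disj f g hf hg hfg := by
    have hψmono : Monotone fun x => ψ x f :=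
      monotone_of_nonneg (isLinearMap_orbit_vector hD hO hDO hψ f)
        fun x hx => orbit_functional_nonneg hD hO hDO hψ hx hf
    have hγf : 0 ≤ γ F f := hD.nonneg_iff.2 fun x hx => by
      rw [hγ]
      exact hBO.apply_nonneg hF _ (orbit_functional_nonneg hD hO hDO hψ hx hf)
    refine le_antisymm ((hD.le_iff _ _).2 fun x hx => ?_) (le_inf hγf hg)
    rw [(hD.lin_vec x).map_zero]
    refine le_of_forall_pos_le_add fun ε hε => ?_
    obtain ⟨z, hanti, hz0, hzx, hfz, hgz⟩ := exists_antitone_decomposition (hD.lin_fun f)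
      (hD.lin_fun g) (hD.apply_nonneg hf) (hD.apply_nonneg hg)
      (fun ε hε => hD.exists_decomposition hf hg hfg hx hε) (half_pos hε)
    obtain ⟨n, hn⟩ := hBO.exists_apply_lt_of_antitone hDO F (ζ := fun n => ψ (z n) f)
      (fun m n hmn => hψmono (hanti hmn))
      (fun n => orbit_functional_nonneg hD hO hDO hψ (hz0 n) hf)
      (fun a ha δ hδ => by
        simp only [hψ]
        refine exists_lt_of_forall_mul_le (t := pE f (ρ a (ρ a x))) (half_pos hε)
          (fun n m hm => ?_) hfz hδ
        have hρ := hO.isPosOrtho ha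
        have h1 := monotone_of_nonneg (hD.lin_fun f) (hD.apply_nonneg hf)
          ((hρ.smul_le hm.le (hz0 n)).trans
            (add_le_add le_rfl (hρ.mono (hρ.mono (hzx n)))))
        rwa [(hD.lin_fun f).map_add, (hD.lin_fun f).map_smul, (hD.lin_fun f).map_smul] at h1)
      (half_pos hε)
    have h2 := hD.inf_apply_le (γ F f) g (hz0 n) (hzx n)
    rw [hγ] at h2
    have h3 := hgz n
    linarith

lemma isOrtho_arensHom (hD : IsOrderDual E D pE) (hO : IsOrthAlg E O ρ)
    (hDO : IsOrderDual O DO pO) (hBO : IsOrderContinuousDual DO BO pB)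
    (hψ : ∀ x f π, pO (ψ x f) π = pE f (ρ π x))
    (hγ : ∀ F f x, pE (γ F f) x = pB F (ψ x f)) (F : BO) : IsOrtho (γ F) := by
  have hp := isPosOrtho_arensHom hD hO hDO hBO hψ hγ (posPart_nonneg F)
  have hn := isPosOrtho_arensHom hD hO hDO hBO hψ hγ (negPart_nonneg F)
  have hsub : ∀ f, γ F f = γ F⁺ f - γ F⁻ f := fun f => by
    rw [← (isLinearMap_arensHom_left hD hBO hγ f).map_sub, posPart_sub_negPart]
  refine ⟨isLinearMap_arensHom hD hDO hBO hψ hγ F, isOrdBdd_of_monotone_sub hp.mono hn.mono hsub,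
    fun f g hfg => ?_⟩
  have habs : ∀ {T : D → D}, IsPosOrtho T → |T f| ≤ T |f| := fun {T} hT =>
    abs_le'.2 ⟨hT.mono (le_abs_self f), by
      rw [← hT.lin.map_neg]
      exact hT.mono (neg_le_abs f)⟩
  have hle : |γ F f| ≤ γ F⁺ |f| + γ F⁻ |f| := by
    rw [hsub, sub_eq_add_neg]
    refine (abs_add_le _ _).trans ?_
    rw [abs_neg]
    exact add_le_add (habs hp) (habs hn)
  exact inf_eq_zero_of_le (abs_nonneg _) (abs_nonneg _) hle le_rfl
    (add_inf_eq_zero (hp.nonneg _ (abs_nonneg f)) (hn.nonneg _ (abs_nonneg f)) (abs_nonneg g)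
      (hp.disj _ _ (abs_nonneg f) (abs_nonneg g) hfg)
      (hn.disj _ _ (abs_nonneg f) (abs_nonneg g) hfg))

lemma eq_orbit_functional (hD : IsOrderDual E D pE) (hO : IsOrthAlg E O ρ)
    (hDO : IsOrderDual O DO pO) (hψ : ∀ x f π, pO (ψ x f) π = pE f (ρ π x)) {x : E} {f : D}
    {a : O} {θ : DO} (hθ : ∀ b, pO θ b = pO (ψ x f) (a * b)) : θ = ψ (ρ a x) f :=
  hDO.inj _ _ fun b => by rw [hθ, hψ, hψ, hO.map_mul, hO.apply_comm hD]

lemma arensHom_one (hD : IsOrderDual E D pE) (hO : IsOrthAlg E O ρ)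
    (hArens : IsArensAlgebra pO pB) (hψ : ∀ x f π, pO (ψ x f) π = pE f (ρ π x))
    (hγ : ∀ F f x, pE (γ F f) x = pB F (ψ x f)) (f : D) : γ 1 f = f :=
  hD.inj _ _ fun x => by rw [hγ, hArens.one_def, hψ, hO.map_one]

lemma arensHom_mul (hD : IsOrderDual E D pE) (hO : IsOrthAlg E O ρ)
    (hDO : IsOrderDual O DO pO) (hArens : IsArensAlgebra pO pB)
    (hψ : ∀ x f π, pO (ψ x f) π = pE f (ρ π x))
    (hγ : ∀ F f x, pE (γ F f) x = pB F (ψ x f)) (F G : BO) (f : D) :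
    γ (F * G) f = γ F (γ G f) := hD.inj _ _ fun x => by
  rw [hγ, hγ]
  refine hArens.mul_def F G (ψ x f) (ψ x (γ G f)) fun a θ hθ => ?_
  rw [eq_orbit_functional hD hO hDO hψ hθ, hψ, hγ]

lemma arensHom_disjoint_of_le_one (hD : IsOrderDual E D pE) (hO : IsOrthAlg E O ρ)
    (hDO : IsOrderDual O DO pO) (hBO : IsOrderContinuousDual DO BO pB)
    (hArens : IsArensAlgebra pO pB) (hψ : ∀ x f π, pO (ψ x f) π = pE f (ρ π x))
    (hγ : ∀ F f x, pE (γ F f) x = pB F (ψ x f)) {F G : BO} (hF : 0 ≤ F) (hG : 0 ≤ G)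
    (hFG : F ⊓ G = 0) (hG1 : G ≤ 1) {f : D} (hf : 0 ≤ f) : γ F f ⊓ γ G f = 0 := by
  have hA := isPosOrtho_arensHom hD hO hDO hBO hψ hγ hF
  have hB := isPosOrtho_arensHom hD hO hDO hBO hψ hγ hG
  obtain ⟨dot, hdot⟩ := hO.exists_dot hDO
  have hAB : γ F (γ G f) ≤ 0 := (hD.le_iff _ _).2 fun x hx => by
    rw [hγ, (hD.lin_vec x).map_zero]
    refine hO.apply_bidual_dot_nonpos hDO hBO hdot hF hG hFG (fun θ hθ => ?_)
      (orbit_functional_nonneg hD hO hDO hψ hx hf) fun a => ?_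
    · rw [← hArens.one_def]
      exact (hBO.le_iff _ _).1 hG1 θ hθ
    · rw [hψ, hγ, eq_orbit_functional hD hO hDO hψ (hdot (ψ x f) a)]
  have hw : 0 ≤ γ F f ⊓ γ G f := le_inf (hA.nonneg f hf) (hB.nonneg f hf)
  exact le_antisymm (hD.archimedean fun n => hA.smul_le_of_apply_eq_zero hw
    ((hA.mono inf_le_right).trans hAB) inf_le_left n.cast_nonneg hf) hw

lemma arensHom_disjoint (hD : IsOrderDual E D pE) (hO : IsOrthAlg E O ρ)
    (hDO : IsOrderDual O DO pO) (hBO : IsOrderContinuousDual DO BO pB)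
    (hArens : IsArensAlgebra pO pB) (hψ : ∀ x f π, pO (ψ x f) π = pE f (ρ π x))
    (hγ : ∀ F f x, pE (γ F f) x = pB F (ψ x f)) {F G : BO} (hF : 0 ≤ F) (hG : 0 ≤ G)
    (hFG : F ⊓ G = 0) {f : D} (hf : 0 ≤ f) : γ F f ⊓ γ G f = 0 := by
  have h1 : (0 : BO) ≤ 1 := hBO.nonneg_iff.2 fun θ hθ => by
    rw [hArens.one_def]
    exact hDO.apply_nonneg hθ _ hO.one_nonneg
  have hA := isPosOrtho_arensHom hD hO hDO hBO hψ hγ hF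
  have hlin := isLinearMap_arensHom_left hD hBO hγ f
  have hpos : ∀ {H : BO}, 0 ≤ H → 0 ≤ γ H f := fun hH =>
    (isPosOrtho_arensHom hD hO hDO hBO hψ hγ hH).nonneg f hf
  have hG' : 0 ≤ G ⊓ 1 := le_inf hG h1
  have hP := posPart_nonneg (G - 1)
  have hN := negPart_nonneg (G - 1)
  have hGP : G ⊓ 1 + (G - 1)⁺ = G := by rw [inf_eq_sub_posPart_sub, sub_add_cancel]
  have hGN : G ⊓ 1 + (G - 1)⁻ = 1 := by
    rw [inf_eq_sub_posPart_sub, sub_add, posPart_sub_negPart, sub_sub_cancel]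
  have hN1 : (G - 1)⁻ ≤ 1 := (le_add_of_nonneg_left hG').trans_eq hGN
  have hFG' : γ F f ⊓ γ (G ⊓ 1) f = 0 := arensHom_disjoint_of_le_one hD hO hDO hBO hArens hψ hγ
    hF hG' (inf_eq_zero_of_le hF hG' le_rfl inf_le_left hFG) inf_le_right hf
  have hPN : γ (G - 1)⁺ f ⊓ γ (G - 1)⁻ f = 0 := arensHom_disjoint_of_le_one hD hO hDO hBO hArens
    hψ hγ hP hN (posPart_inf_negPart_eq_zero _) hN1 hf
  have hw : 0 ≤ γ F f ⊓ γ (G - 1)⁺ f := le_inf (hpos hF) (hpos hP)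
  have hwf : f ⊓ (γ F f ⊓ γ (G - 1)⁺ f) = 0 := by
    have hsum : f = γ (G ⊓ 1) f + γ (G - 1)⁻ f := by
      rw [← hlin.map_add, hGN, arensHom_one hD hO hArens hψ hγ]
    conv_lhs => arg 1; rw [hsum]
    refine add_inf_eq_zero (hpos hG') (hpos hN) hw ?_ ?_
    · rw [inf_comm]
      exact inf_eq_zero_of_le hw (hpos hG') inf_le_left le_rfl hFG'
    · rw [inf_comm]
      exact inf_eq_zero_of_le hw (hpos hN) inf_le_right le_rfl hPN
  have hFP : γ F f ⊓ γ (G - 1)⁺ f = 0 := by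
    rw [← hA.disj _ _ hf hw hwf, ← inf_assoc, inf_idem]
  rw [← hGP, hlin.map_add, inf_comm]
  refine add_inf_eq_zero (hpos hG') (hpos hP) (hpos hF) ?_ ?_
  · rwa [inf_comm]
  · rwa [inf_comm]

lemma arensHom_sup (hD : IsOrderDual E D pE) (hO : IsOrthAlg E O ρ)
    (hDO : IsOrderDual O DO pO) (hBO : IsOrderContinuousDual DO BO pB)
    (hArens : IsArensAlgebra pO pB) (hψ : ∀ x f π, pO (ψ x f) π = pE f (ρ π x))
    (hγ : ∀ F f x, pE (γ F f) x = pB F (ψ x f)) (F G : BO) {f : D} (hf : 0 ≤ f) :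
    γ (F ⊔ G) f = γ F f ⊔ γ G f := by
  have hlin := isLinearMap_arensHom_left hD hBO hγ f
  have hdisj := arensHom_disjoint hD hO hDO hBO hArens hψ hγ (posPart_nonneg (F - G))
    (negPart_nonneg (F - G)) (posPart_inf_negPart_eq_zero _) hf
  rw [sup_eq_add_posPart_sub F G, hlin.map_add, sup_eq_add_posPart_sub (γ F f), ← hlin.map_sub,
    ← posPart_sub_of_inf_eq_zero hdisj, ← hlin.map_sub, posPart_sub_negPart]

lemma isGLB_arensHom (hD : IsOrderDual E D pE) (hO : IsOrthAlg E O ρ)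
    (hDO : IsOrderDual O DO pO) (hBO : IsOrderContinuousDual DO BO pB)
    (hψ : ∀ x f π, pO (ψ x f) π = pE f (ρ π x))
    (hγ : ∀ F f x, pE (γ F f) x = pB F (ψ x f)) {s : Set BO} (hs : s.Nonempty)
    (hdir : DirectedOn (· ≥ ·) s) (hglb : IsGLB s 0) {f : D} (hf : 0 ≤ f) :
    IsGLB ((fun F => γ F f) '' s) 0 := by
  refine ⟨?_, fun g hg => (hD.le_iff _ _).2 fun x hx => ?_⟩
  · rintro _ ⟨F, hF, rfl⟩
    exact (isPosOrtho_arensHom hD hO hDO hBO hψ hγ (hglb.1 hF)).nonneg f hf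
  · rw [(hD.lin_vec x).map_zero]
    refine le_of_forall_pos_le_add fun ε hε => ?_
    obtain ⟨F, hF, hlt⟩ := hBO.exists_apply_lt_of_isGLB hs hdir hglb
      (orbit_functional_nonneg hD hO hDO hψ hx hf) hε
    have h1 := (hD.le_iff _ _).1 (hg ⟨F, hF, rfl⟩) x hx
    rw [hγ] at h1
    linarith

end ArensHom

/-- Proposition 1.  Let `E` be a Riesz space with point separating order
dual `E^∼` (realized as `D`).  The Arens homomorphism
`γ : ((Orth E)^∼)ₙ^∼ → L_b(E^∼)`, `γ(F)(f)(x) = F(ψ_{x,f})` with `ψ_{x,f}(π) = f(πx)`,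
is a unital algebra homomorphism and an order continuous Riesz homomorphism whose range
is contained in `Orth(E^∼)`.  Here `O` realizes `Orth(E)`, `DO` realizes `(Orth E)^∼`,
`BO` realizes `((Orth E)^∼)ₙ^∼` with its Arens `f`-algebra structure. -/
theorem statement0
    {E D O DO BO : Type*}
    [Lattice E] [AddCommGroup E] [Module ℝ E]
    [CovariantClass E E (· + ·) (· ≤ ·)] [PosSMulMono ℝ E]
    [Lattice D] [AddCommGroup D] [Module ℝ D]
    [CovariantClass D D (· + ·) (· ≤ ·)] [PosSMulMono ℝ D]
    [Lattice O] [Ring O] [Module ℝ O]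
    [CovariantClass O O (· + ·) (· ≤ ·)] [PosSMulMono ℝ O]
    [Lattice DO] [AddCommGroup DO] [Module ℝ DO]
    [CovariantClass DO DO (· + ·) (· ≤ ·)] [PosSMulMono ℝ DO]
    [Lattice BO] [Ring BO] [Module ℝ BO]
    [CovariantClass BO BO (· + ·) (· ≤ ·)] [PosSMulMono ℝ BO]
    (pE : D → E → ℝ) (hD : IsOrderDual E D pE) (hsep : SepPoints pE)
    (ρ : O → E → E) (hO : IsOrthAlg E O ρ)
    (pO : DO → O → ℝ) (hDO : IsOrderDual O DO pO)
    (pB : BO → DO → ℝ) (hBO : IsOrderContinuousDual DO BO pB)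
    (hArens : IsArensAlgebra pO pB)
    (γ : BO → D → D)
    (hγ : ∀ (F : BO) (f : D) (x : E) (ψ : DO),
      (∀ π : O, pO ψ π = pE f (ρ π x)) → pE (γ F f) x = pB F ψ) :
    -- the range of `γ` is contained in `Orth(E^∼)`
    (∀ F : BO, IsOrtho (γ F)) ∧
    -- `γ` is linear
    (∀ f : D, IsLinearMap ℝ fun F => γ F f) ∧
    -- `γ` is unital
    (∀ f : D, γ 1 f = f) ∧
    -- `γ` is an algebra homomorphism
    (∀ (F G : BO) (f : D), γ (F * G) f = γ F (γ G f)) ∧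
    -- `γ` is a Riesz homomorphism (lattice operations of orthomorphisms are pointwise on
    -- positive elements)
    (∀ (F G : BO) (f : D), 0 ≤ f → γ (F ⊔ G) f = γ F f ⊔ γ G f) ∧
    -- `γ` is order continuous
    (∀ s : Set BO, s.Nonempty → DirectedOn (· ≥ ·) s → IsGLB s 0 →
      ∀ f : D, 0 ≤ f → IsGLB ((fun F => γ F f) '' s) 0) := by

  have : IsOrderedAddMonoid E := { add_le_add_left := fun _ _ h c => add_le_add_left h c }
  have : IsOrderedAddMonoid D := { add_le_add_left := fun _ _ h c => add_le_add_left h c }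
  have : IsOrderedAddMonoid O := { add_le_add_left := fun _ _ h c => add_le_add_left h c }
  have : IsOrderedAddMonoid DO := { add_le_add_left := fun _ _ h c => add_le_add_left h c }
  have : IsOrderedAddMonoid BO := { add_le_add_left := fun _ _ h c => add_le_add_left h c }
  obtain ⟨ψ, hψ⟩ := hO.exists_orbit_functional hD hDO
  have hγ' : ∀ F f x, pE (γ F f) x = pB F (ψ x f) := fun F f x => hγ F f x _ (hψ x f)
  exact ⟨isOrtho_arensHom hD hO hDO hBO hψ hγ', isLinearMap_arensHom_left hD hBO hγ',
    arensHom_one hD hO hArens hψ hγ', arensHom_mul hD hO hDO hArens hψ hγ',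
    fun F G _ hf => arensHom_sup hD hO hDO hBO hArens hψ hγ' F G hf,
    fun _ hs hdir hglb _ hf => isGLB_arensHom hD hO hDO hBO hψ hγ' hs hdir hglb hf⟩
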